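/- arXiv:2006.14455 — 2 statements merged into one kernel-verified Lean document; each statement's English description precedes it below -/
import Mathlib

section
/- Let b be a slowly varying function, q ∈ (1,∞), and suppose that either (1) p ∈ [1,∞), or (2) p = ∞, ∫₁^∞ t^{−1} b^q(t) dt = ∞, and sup_{t∈(0,∞)} ( ∫₀ᵗ s^{−1} b^q(s) ds )^{1/q} · ( ∫_t^∞ s^{−1} b^{−q'}(s) ds )^{1/q'} < ∞, where q' = q/(q−1). Then (L^{p,q,b})' = L^{(p',q',b^{−1})} up to equivalence of the defining functionals, where p' = p/(p−1) for p ∈ (1,∞), p' = ∞ for p = 1, and p' = 1 for p = ∞; i.e. there are positive constants c, C with c‖f‖_{(p',q',b^{−1})} ≤ ‖f‖_{(L^{p,q,b})'} ≤ C‖f‖_{(p',q',b^{−1})} for all μ-measurable f. -/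
open MeasureTheory Set Filter ENNReal Topology

noncomputable section

/-- `f ≈ g` on `S`: two-sided equivalence with positive constants. -/
def EquivOn (f g : ℝ → ℝ) (S : Set ℝ) : Prop :=
  ∃ c C : ℝ, 0 < c ∧ 0 < C ∧ ∀ t ∈ S, c * g t ≤ f t ∧ f t ≤ C * g t

/-- A measurable positive function on `(0,∞)` is slowly varying if for every `ε > 0`,
`t ^ ε * b t` is equivalent to a non-decreasing function and `t ^ (-ε) * b t` is
equivalent to a non-increasing function on `(0,∞)`. -/
def IsSlowlyVarying (b : ℝ → ℝ) : Prop :=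
  Measurable b ∧ (∀ t ∈ Set.Ioi (0:ℝ), 0 < b t) ∧
    ∀ ε : ℝ, 0 < ε →
      (∃ bp : ℝ → ℝ, MonotoneOn bp (Set.Ioi 0) ∧
        EquivOn (fun t => t ^ ε * b t) bp (Set.Ioi 0)) ∧
      (∃ bm : ℝ → ℝ, AntitoneOn bm (Set.Ioi 0) ∧
        EquivOn (fun t => t ^ (-ε) * b t) bm (Set.Ioi 0))

/-- The non-increasing rearrangement `f*` (with values in `ℝ≥0∞`). -/
def rearr {X : Type*} [MeasurableSpace X] (μ : Measure X) (f : X → ℝ) (t : ℝ) : ℝ≥0∞ :=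
  sInf {s : ℝ≥0∞ | μ {x | s < ENNReal.ofReal |f x|} ≤ ENNReal.ofReal t}

/-- The maximal function `f**(t) = (1/t) ∫₀ᵗ f*`. -/
def maxf {X : Type*} [MeasurableSpace X] (μ : Measure X) (f : X → ℝ) (t : ℝ) : ℝ≥0∞ :=
  (ENNReal.ofReal t)⁻¹ * ∫⁻ s in Set.Ioo (0:ℝ) t, rearr μ f s

/-- The `L^q` "norm" over a subset `S ⊆ ℝ` of an `ℝ≥0∞`-valued function. -/
def lqNorm (q : ℝ≥0∞) (S : Set ℝ) (g : ℝ → ℝ≥0∞) : ℝ≥0∞ :=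
  if q = ∞ then essSup g (volume.restrict S)
  else (∫⁻ t in S, g t ^ q.toReal) ^ (1 / q.toReal)

/-- The Lorentz–Karamata functional `‖f‖_{p,q,b}`. -/
def lkNorm {X : Type*} [MeasurableSpace X] (μ : Measure X) (p q : ℝ≥0∞) (b : ℝ → ℝ)
    (f : X → ℝ) : ℝ≥0∞ :=
  lqNorm q (Set.Ioi 0)
    (fun t => ENNReal.ofReal (t ^ (p⁻¹.toReal - q⁻¹.toReal) * b t) * rearr μ f t)

/-- The Lorentz–Karamata functional `‖f‖_{(p,q,b)}` defined via the maximal function. -/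
def lkMaxNorm {X : Type*} [MeasurableSpace X] (μ : Measure X) (p q : ℝ≥0∞) (b : ℝ → ℝ)
    (f : X → ℝ) : ℝ≥0∞ :=
  lqNorm q (Set.Ioi 0)
    (fun t => ENNReal.ofReal (t ^ (p⁻¹.toReal - q⁻¹.toReal) * b t) * maxf μ f t)

/-- The `L^q(0,∞)` norm of `t ^ (1/p - 1/q) * b t` restricted to `S`. -/
def weightNorm (p q : ℝ≥0∞) (b : ℝ → ℝ) (S : Set ℝ) : ℝ≥0∞ :=
  lqNorm q S (fun t => ENNReal.ofReal (t ^ (p⁻¹.toReal - q⁻¹.toReal) * b t))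

/-- A measure is non-atomic. -/
def IsNonatomic {X : Type*} [MeasurableSpace X] (μ : Measure X) : Prop :=
  ∀ s : Set X, MeasurableSet s → 0 < μ s →
    ∃ t, t ⊆ s ∧ MeasurableSet t ∧ 0 < μ t ∧ μ t < μ s

/-- `b̃(t) = ∫₀ᵗ s⁻¹ b(s) ds`. -/
def svTilde (b : ℝ → ℝ) (t : ℝ) : ℝ≥0∞ :=
  ∫⁻ s in Set.Ioo (0:ℝ) t, ENNReal.ofReal (s⁻¹ * b s)

/-- `b̃_∞(t) = esssup_{s ∈ (0,t)} b(s)`. -/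
def svTildeSup (b : ℝ → ℝ) (t : ℝ) : ℝ≥0∞ :=
  essSup (fun s => ENNReal.ofReal (b s)) (volume.restrict (Set.Ioo (0:ℝ) t))

/-- `b̂(t) = ∫_t^∞ s⁻¹ b(s) ds`. -/
def svHat (b : ℝ → ℝ) (t : ℝ) : ℝ≥0∞ :=
  ∫⁻ s in Set.Ioi t, ENNReal.ofReal (s⁻¹ * b s)

/-- `b̂_∞(t) = esssup_{s ∈ (t,∞)} b(s)`. -/
def svHatSup (b : ℝ → ℝ) (t : ℝ) : ℝ≥0∞ :=
  essSup (fun s => ENNReal.ofReal (b s)) (volume.restrict (Set.Ioi t))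

/-- The associate functional of a functional `N`. -/
def assocNorm {X : Type*} [MeasurableSpace X] (μ : Measure X) (N : (X → ℝ) → ℝ≥0∞)
    (f : X → ℝ) : ℝ≥0∞ :=
  ⨆ (g : X → ℝ) (_ : Measurable g) (_ : N g ≤ 1), ∫⁻ x, ENNReal.ofReal |f x * g x| ∂μ

/-- The conjugate exponent: `q' = q/(q-1)` for `q ∈ (1,∞)`, `1' = ∞`, `∞' = 1`. -/
def conjE (q : ℝ≥0∞) : ℝ≥0∞ := (1 - q⁻¹)⁻¹

/-- The interval `(0, μ(R))` inside `ℝ`, where `μ(R)` may be infinite. -/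
def IooMu {X : Type*} [MeasurableSpace X] (μ : Measure X) : Set ℝ :=
  {t : ℝ | 0 < t ∧ ENNReal.ofReal t < μ Set.univ}

/-- The embedding `L^{p₁,q₁,b₁} ↪ L^{p₂,q₂,b₂}`. -/
def lkEmbed {X : Type*} [MeasurableSpace X] (μ : Measure X) (p1 q1 : ℝ≥0∞) (b1 : ℝ → ℝ)
    (p2 q2 : ℝ≥0∞) (b2 : ℝ → ℝ) : Prop :=
  ∃ C : ℝ≥0∞, C < ∞ ∧ ∀ f : X → ℝ, Measurable f →
    lkNorm μ p2 q2 b2 f ≤ C * lkNorm μ p1 q1 b1 f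

/-- A rearrangement-invariant quasi-Banach function norm. -/
structure IsRIQuasiBFN {X : Type*} [MeasurableSpace X] (μ : Measure X)
    (N : (X → ℝ) → ℝ≥0∞) : Prop where
  abs_eq : ∀ f : X → ℝ, Measurable f → N (fun x => |f x|) = N f
  smul : ∀ (a : ℝ) (f : X → ℝ), Measurable f →
    N (fun x => a * f x) = ENNReal.ofReal |a| * N f
  eq_zero_iff : ∀ f : X → ℝ, Measurable f → (N f = 0 ↔ f =ᵐ[μ] 0)
  quasi_add : ∃ C : ℝ≥0∞, C < ∞ ∧ ∀ f g : X → ℝ, Measurable f → Measurable g →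
    N (fun x => f x + g x) ≤ C * (N f + N g)
  mono : ∀ f g : X → ℝ, Measurable f → Measurable g →
    (∀ᵐ x ∂μ, |f x| ≤ |g x|) → N f ≤ N g
  fatou : ∀ (f : ℕ → X → ℝ) (g : X → ℝ), (∀ n, Measurable (f n)) → Measurable g →
    (∀ᵐ x ∂μ, ∀ n, 0 ≤ f n x) → (∀ᵐ x ∂μ, Monotone fun n => f n x) →
    (∀ᵐ x ∂μ, Filter.Tendsto (fun n => f n x) Filter.atTop (nhds (g x))) →
    N g = ⨆ n, N (f n)
  ind_lt_top : ∀ E : Set X, MeasurableSet E → μ E < ∞ →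
    N (Set.indicator E fun _ => (1:ℝ)) < ∞
  rearr_inv : ∀ f g : X → ℝ, Measurable f → Measurable g →
    rearr μ f = rearr μ g → N f = N g

/-- A rearrangement-invariant Banach function norm. -/
structure IsRIBFN {X : Type*} [MeasurableSpace X] (μ : Measure X)
    (N : (X → ℝ) → ℝ≥0∞) : Prop where
  abs_eq : ∀ f : X → ℝ, Measurable f → N (fun x => |f x|) = N f
  smul : ∀ (a : ℝ) (f : X → ℝ), Measurable f →
    N (fun x => a * f x) = ENNReal.ofReal |a| * N f
  eq_zero_iff : ∀ f : X → ℝ, Measurable f → (N f = 0 ↔ f =ᵐ[μ] 0)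
  add_le : ∀ f g : X → ℝ, Measurable f → Measurable g →
    N (fun x => f x + g x) ≤ N f + N g
  mono : ∀ f g : X → ℝ, Measurable f → Measurable g →
    (∀ᵐ x ∂μ, |f x| ≤ |g x|) → N f ≤ N g
  fatou : ∀ (f : ℕ → X → ℝ) (g : X → ℝ), (∀ n, Measurable (f n)) → Measurable g →
    (∀ᵐ x ∂μ, ∀ n, 0 ≤ f n x) → (∀ᵐ x ∂μ, Monotone fun n => f n x) →
    (∀ᵐ x ∂μ, Filter.Tendsto (fun n => f n x) Filter.atTop (nhds (g x))) →
    N g = ⨆ n, N (f n)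
  ind_lt_top : ∀ E : Set X, MeasurableSet E → μ E < ∞ →
    N (Set.indicator E fun _ => (1:ℝ)) < ∞
  integral_le : ∀ E : Set X, MeasurableSet E → μ E < ∞ →
    ∃ C : ℝ≥0∞, C < ∞ ∧ ∀ f : X → ℝ, Measurable f →
      ∫⁻ x in E, ENNReal.ofReal |f x| ∂μ ≤ C * N f
  rearr_inv : ∀ f g : X → ℝ, Measurable f → Measurable g →
    rearr μ f = rearr μ g → N f = N g

end

theorem lintegral_Ioo_rpow_sub_one {a t : ℝ} (ha : 0 < a) (ht : 0 < t) :
    ∫⁻ s in Ioo 0 t, ENNReal.ofReal (s ^ (a - 1)) = ENNReal.ofReal (t ^ a / a) := by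
  have hint : IntervalIntegrable (fun s : ℝ => s ^ (a - 1)) volume 0 t :=
    intervalIntegral.intervalIntegrable_rpow' (by linarith)
  have hval : ∫ s in (0 : ℝ)..t, s ^ (a - 1) = t ^ a / a := by
    rw [integral_rpow (Or.inl (by linarith))]
    simp [Real.zero_rpow ha.ne']
  rw [← hval, intervalIntegral.integral_of_le ht.le, restrict_Ioo_eq_restrict_Ioc,
    ofReal_integral_eq_lintegral_ofReal]
  · exact (intervalIntegrable_iff_integrableOn_Ioc_of_le ht.le).1 hint
  · filter_upwards [ae_restrict_mem measurableSet_Ioc] with s hs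
    exact Real.rpow_nonneg hs.1.le _

theorem lintegral_Ioi_rpow_neg_sub_one {a t : ℝ} (ha : 0 < a) (ht : 0 < t) :
    ∫⁻ s in Ioi t, ENNReal.ofReal (s ^ (-a - 1)) = ENNReal.ofReal (t ^ (-a) / a) := by
  have hval : ∫ s in Ioi t, s ^ (-a - 1) = t ^ (-a) / a := by
    rw [integral_Ioi_rpow_of_lt (by linarith) ht]
    simp [neg_div_neg_eq]
  rw [← hval, ofReal_integral_eq_lintegral_ofReal]
  · exact integrableOn_Ioi_rpow_of_lt (by linarith) ht
  · filter_upwards [ae_restrict_mem measurableSet_Ioi] with s hs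
    exact Real.rpow_nonneg (ht.le.trans (le_of_lt hs)) _

/-- If the distribution of `U` is dominated by Lebesgue measure on `(0, ν(Y))`, then so are its
negative power integrals. -/
theorem lintegral_rpow_neg_le {Y : Type*} [MeasurableSpace Y] (ν : Measure Y)
    (hfin : ν univ ≠ ∞) {U : Y → ℝ≥0∞} (hU : Measurable U)
    (hdist : ∀ y : ℝ≥0∞, ν {x | U x < y} ≤ y) (h0 : ∀ᵐ x ∂ν, U x ≠ 0)
    {θ : ℝ} (hθ0 : 0 < θ) (hθ1 : θ < 1) :
    ∫⁻ x, U x ^ (-θ) ∂ν ≤ ENNReal.ofReal (1 - θ)⁻¹ * ν univ ^ (1 - θ) := by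
  rcases eq_or_ne (ν univ) 0 with hz | hz
  · simp [Measure.measure_univ_eq_zero.1 hz]
  set m : ℝ := (ν univ).toReal with hm
  have hm0 : 0 < m := ENNReal.toReal_pos hz hfin
  have hmu : ν univ = ENNReal.ofReal m := (ENNReal.ofReal_toReal hfin).symm
  have hmi : 0 < m⁻¹ := inv_pos.2 hm0
  have hsub : (1 : ℝ) - θ > 0 := by linarith
  have e1 : ∫⁻ x, U x ^ (-θ) ∂ν = ∫⁻ x, ENNReal.ofReal (((U x)⁻¹.toReal) ^ θ) ∂ν := by
    apply lintegral_congr_ae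
    filter_upwards [h0] with x hx
    rw [ENNReal.rpow_neg, ← ENNReal.inv_rpow,
      ← ENNReal.ofReal_rpow_of_nonneg ENNReal.toReal_nonneg hθ0.le, ENNReal.ofReal_toReal]
    simpa using hx
  have hmeas : ∀ t ∈ Ioi (0 : ℝ),
      ν {x | t < (U x)⁻¹.toReal} ≤ min (ENNReal.ofReal m) (ENNReal.ofReal t⁻¹) := by
    intro t ht
    refine le_min ((measure_mono (subset_univ _)).trans hmu.le) ?_
    refine (measure_mono ?_).trans (hdist (ENNReal.ofReal t⁻¹))
    intro x hx
    simp only [mem_ofPred_eq] at hx ⊢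
    have h1 : ENNReal.ofReal t < (U x)⁻¹ := (ENNReal.ofReal_lt_iff_lt_toReal (le_of_lt ht)
      (fun h => by rw [h] at hx; simp at hx; exact lt_asymm hx ht)).2 hx
    rw [ENNReal.ofReal_inv_of_pos ht]
    exact ENNReal.lt_inv_iff_lt_inv.1 h1
  rw [e1, lintegral_rpow_eq_lintegral_meas_lt_mul ν (f := fun x => (U x)⁻¹.toReal)
    (Eventually.of_forall fun _ => toReal_nonneg)
    (hU.inv.ennreal_toReal).aemeasurable hθ0]
  have split : Ioi (0 : ℝ) = Ioc 0 m⁻¹ ∪ Ioi m⁻¹ := (Ioc_union_Ioi_eq_Ioi hmi.le).symm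
  have b1 : ∫⁻ t in Ioc 0 m⁻¹, ν {x | t < (U x)⁻¹.toReal} * ENNReal.ofReal (t ^ (θ - 1))
      ≤ ENNReal.ofReal (m * (m⁻¹ ^ θ / θ)) := by
    rw [ENNReal.ofReal_mul hm0.le, ← lintegral_Ioo_rpow_sub_one hθ0 hmi,
      restrict_Ioo_eq_restrict_Ioc, ← lintegral_const_mul' _ _ ofReal_ne_top]
    refine setLIntegral_mono' measurableSet_Ioc fun t ht => ?_
    gcongr
    exact (hmeas t ht.1).trans (min_le_left _ _)
  have b2 : ∫⁻ t in Ioi m⁻¹, ν {x | t < (U x)⁻¹.toReal} * ENNReal.ofReal (t ^ (θ - 1))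
      ≤ ENNReal.ofReal (m⁻¹ ^ (-(1 - θ)) / (1 - θ)) := by
    rw [← lintegral_Ioi_rpow_neg_sub_one hsub hmi]
    refine setLIntegral_mono' measurableSet_Ioi fun t ht => ?_
    have ht0 : (0 : ℝ) < t := hmi.trans ht
    refine (mul_le_mul_left ((hmeas t ht0).trans (min_le_right _ _)) _).trans ?_
    rw [← ENNReal.ofReal_mul (by positivity), ← Real.rpow_neg_one, ← Real.rpow_add ht0]
    apply le_of_eq
    congr 2
    ring
  calc _ ≤ ENNReal.ofReal θ * (ENNReal.ofReal (m * (m⁻¹ ^ θ / θ)) +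
        ENNReal.ofReal (m⁻¹ ^ (-(1 - θ)) / (1 - θ))) := by
        gcongr
        rw [split]
        exact (lintegral_union_le _ _ _).trans (add_le_add b1 b2)
    _ = ENNReal.ofReal (1 - θ)⁻¹ * ν univ ^ (1 - θ) := by
        rw [hmu, ENNReal.ofReal_rpow_of_pos hm0, ← ENNReal.ofReal_add (by positivity)
          (by positivity), ← ENNReal.ofReal_mul hθ0.le, ← ENNReal.ofReal_mul (by positivity)]
        congr 1
        have h1 : m * m⁻¹ ^ θ = m ^ (1 - θ) := by
          rw [Real.inv_rpow hm0.le, Real.rpow_sub hm0, Real.rpow_one]; rfl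
        have h2 : m⁻¹ ^ (-(1 - θ)) = m ^ (1 - θ) := by
          rw [Real.rpow_neg hmi.le, Real.inv_rpow hm0.le, inv_inv]
        rw [h2, ← mul_div_assoc, h1]
        field_simp
        ring

theorem measure_setOf_measure_Iio_lt_le (ν : Measure ℝ) [IsFiniteMeasure ν] [NullSingletonClass ν]
    (y : ℝ≥0∞) : ν {t | ν (Iio t) < y} ≤ y := by
  have hmeas : MeasurableSet {t | ν (Iio t) < y} := by
    have hmono : Monotone fun t => ν (Iio t) := fun a b h => measure_mono (Iio_subset_Iio h)
    exact measurableSet_lt hmono.measurable measurable_const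
  rw [hmeas.measure_eq_iSup_isCompact]
  refine iSup₂_le fun K hK => iSup_le fun hKc => ?_
  rcases K.eq_empty_or_nonempty with rfl | hne
  · simp
  obtain ⟨t, ht, hmax⟩ := hKc.exists_isGreatest hne
  exact (measure_mono fun s hs => hmax hs).trans ((measure_congr Iio_ae_eq_Iic).symm.le.trans
    (le_of_lt (hK ht)))

theorem measure_setOf_measure_Ioi_lt_le (ν : Measure ℝ) [IsFiniteMeasure ν] [NullSingletonClass ν]
    (y : ℝ≥0∞) : ν {t | ν (Ioi t) < y} ≤ y := by
  have hmeas : MeasurableSet {t | ν (Ioi t) < y} := by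
    have hmono : Antitone fun t => ν (Ioi t) := fun a b h => measure_mono (Ioi_subset_Ioi h)
    exact measurableSet_lt hmono.measurable measurable_const
  rw [hmeas.measure_eq_iSup_isCompact]
  refine iSup₂_le fun K hK => iSup_le fun hKc => ?_
  rcases K.eq_empty_or_nonempty with rfl | hne
  · simp
  obtain ⟨t, ht, hmin⟩ := hKc.exists_isLeast hne
  exact (measure_mono fun s hs => hmin hs).trans ((measure_congr Ioi_ae_eq_Ici).symm.le.trans
    (le_of_lt (hK ht)))

theorem lintegral_Iio_measure_rpow_neg_le (ν : Measure ℝ) [NullSingletonClass ν] {s : ℝ}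
    (hfin : ν (Iio s) ≠ ∞) (h0 : ∀ᵐ t ∂ν, ν (Iio t) ≠ 0) {θ : ℝ} (hθ0 : 0 < θ) (hθ1 : θ < 1) :
    ∫⁻ t in Iio s, ν (Iio t) ^ (-θ) ∂ν ≤ ENNReal.ofReal (1 - θ)⁻¹ * ν (Iio s) ^ (1 - θ) := by
  have : IsFiniteMeasure (ν.restrict (Iio s)) := ⟨by simpa using hfin.lt_top⟩
  have hU : Measurable fun t => ν.restrict (Iio s) (Iio t) :=
    Monotone.measurable fun a b h => measure_mono (Iio_subset_Iio h)
  have heq : ∀ᵐ t ∂ν.restrict (Iio s), ν.restrict (Iio s) (Iio t) = ν (Iio t) := by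
    filter_upwards [ae_restrict_mem measurableSet_Iio] with t ht
    rw [Measure.restrict_apply measurableSet_Iio, Iio_inter_Iio, min_eq_left (le_of_lt ht)]
  have := lintegral_rpow_neg_le (ν.restrict (Iio s)) (by simpa using hfin) hU
    (measure_setOf_measure_Iio_lt_le _) (by
      filter_upwards [heq, ae_restrict_of_ae h0] with t ht ht0
      rwa [ht]) hθ0 hθ1
  rw [Measure.restrict_apply_univ] at this
  refine le_trans (le_of_eq (lintegral_congr_ae ?_)) this
  filter_upwards [heq] with t ht
  rw [ht]

theorem lintegral_Ioi_measure_rpow_neg_le (ν : Measure ℝ) [NullSingletonClass ν] {s : ℝ}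
    (hfin : ν (Ioi s) ≠ ∞) (h0 : ∀ᵐ t ∂ν, ν (Ioi t) ≠ 0) {θ : ℝ} (hθ0 : 0 < θ) (hθ1 : θ < 1) :
    ∫⁻ t in Ioi s, ν (Ioi t) ^ (-θ) ∂ν ≤ ENNReal.ofReal (1 - θ)⁻¹ * ν (Ioi s) ^ (1 - θ) := by
  have : IsFiniteMeasure (ν.restrict (Ioi s)) := ⟨by simpa using hfin.lt_top⟩
  have hU : Measurable fun t => ν.restrict (Ioi s) (Ioi t) :=
    Antitone.measurable fun a b h => measure_mono (Ioi_subset_Ioi h)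
  have heq : ∀ᵐ t ∂ν.restrict (Ioi s), ν.restrict (Ioi s) (Ioi t) = ν (Ioi t) := by
    filter_upwards [ae_restrict_mem measurableSet_Ioi] with t ht
    rw [Measure.restrict_apply measurableSet_Ioi, Ioi_inter_Ioi, sup_eq_left.2 (le_of_lt ht)]
  have := lintegral_rpow_neg_le (ν.restrict (Ioi s)) (by simpa using hfin) hU
    (measure_setOf_measure_Ioi_lt_le _) (by
      filter_upwards [heq, ae_restrict_of_ae h0] with t ht ht0
      rwa [ht]) hθ0 hθ1
  rw [Measure.restrict_apply_univ] at this
  refine le_trans (le_of_eq (lintegral_congr_ae ?_)) this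
  filter_upwards [heq] with t ht
  rw [ht]

/-- The weighted Hardy inequality for `k ↦ ∫_t^∞ k dλ` under Muckenhoupt's condition. -/
theorem lintegral_hardy_rpow_le (ν lam : Measure ℝ) [SFinite ν] [SFinite lam] [NullSingletonClass ν]
    [NullSingletonClass lam] {Q Q' : ℝ} (hQ : Q.HolderConjugate Q') {B : ℝ≥0∞}
    (hν : ν (Iic 0) = 0) (hlam : lam (Iic 0) = 0)
    (hν0 : ∀ t > 0, ν (Iio t) ≠ 0) (hνt : ∀ t > 0, ν (Iio t) ≠ ∞)
    (hlam0 : ∀ t > 0, lam (Ioi t) ≠ 0) (hlamt : ∀ t > 0, lam (Ioi t) ≠ ∞)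
    (hB : ∀ t > 0, ν (Iio t) ^ (1 / Q) * lam (Ioi t) ^ (1 / Q') ≤ B)
    {k : ℝ → ℝ≥0∞} (hk : Measurable k) :
    ∫⁻ t, (∫⁻ s in Ioi t, k s ∂lam) ^ Q ∂ν ≤
      (ENNReal.ofReal Q' * B) ^ (Q / Q') * (ENNReal.ofReal Q * B) * ∫⁻ s, k s ^ Q ∂lam := by
  have hQ0 := hQ.pos
  have hQ'0 := hQ.symm.pos
  have hne : Q ≠ 0 := hQ0.ne'
  have hne' : Q' ≠ 0 := hQ'0.ne'
  have hsum : 1 / Q + 1 / Q' = 1 := by simpa using hQ.inv_add_inv_eq_one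
  have hi0 : 0 < 1 / Q := by positivity
  have hi0' : 0 < 1 / Q' := by positivity
  have hνpos : ∀ᵐ t ∂ν, 0 < t := by
    rw [ae_iff]; simpa [not_lt, Iic] using hν
  have hlampos : ∀ᵐ t ∂lam, 0 < t := by
    rw [ae_iff]; simpa [not_lt, Iic] using hlam
  have hVm : Measurable fun t => lam (Ioi t) :=
    Antitone.measurable fun a b h => measure_mono (Ioi_subset_Ioi h)
  have hWm : Measurable fun t => ν (Iio t) :=
    Monotone.measurable fun a b h => measure_mono (Iio_subset_Iio h)
  have hν0' : ∀ᵐ t ∂ν, ν (Iio t) ≠ 0 := hνpos.mono fun t ht => hν0 t ht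
  have hlam0' : ∀ᵐ t ∂lam, lam (Ioi t) ≠ 0 := hlampos.mono fun t ht => hlam0 t ht
  have e1 : (1 - 1 / Q)⁻¹ = Q' := by rw [show 1 - 1 / Q = 1 / Q' by linarith]; simp
  have e1' : (1 - 1 / Q')⁻¹ = Q := by rw [show 1 - 1 / Q' = 1 / Q by linarith]; simp
  have e2 : 1 - 1 / Q = 1 / Q' := by linarith
  have e2' : 1 - 1 / Q' = 1 / Q := by linarith
  have pt : ∀ t > 0, (∫⁻ s in Ioi t, k s ∂lam) ^ Q ≤
      (ENNReal.ofReal Q' * B) ^ (Q / Q') * (ν (Iio t) ^ (-(1 / Q')) *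
        ∫⁻ s in Ioi t, k s ^ Q * lam (Ioi s) ^ (1 / Q') ∂lam) := by
    intro t ht
    have h1 : ∫⁻ s in Ioi t, k s ∂lam ≤
        (∫⁻ s in Ioi t, k s ^ Q * lam (Ioi s) ^ (1 / Q') ∂lam) ^ (1 / Q) *
          (∫⁻ s in Ioi t, lam (Ioi s) ^ (-(1 / Q)) ∂lam) ^ (1 / Q') := by
      have := ENNReal.lintegral_mul_le_Lp_mul_Lq (lam.restrict (Ioi t)) hQ
        (f := fun s => k s * lam (Ioi s) ^ (1 / Q' * (1 / Q)))
        (g := fun s => lam (Ioi s) ^ (-(1 / Q) * (1 / Q')))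
        (hk.mul (hVm.pow_const _)).aemeasurable (hVm.pow_const _).aemeasurable
      refine le_trans (le_of_eq (setLIntegral_congr_fun measurableSet_Ioi fun s hs => ?_))
        (this.trans (le_of_eq ?_))
      · have hs0 : 0 < s := ht.trans hs
        simp only [Pi.mul_apply]
        rw [mul_assoc, ← ENNReal.rpow_add _ _ (hlam0 s hs0) (hlamt s hs0)]
        rw [show 1 / Q' * (1 / Q) + -(1 / Q) * (1 / Q') = 0 by ring]
        simp
      · congr 2
        · refine lintegral_congr fun s => ?_
          rw [ENNReal.mul_rpow_of_nonneg _ _ hQ0.le, ← ENNReal.rpow_mul]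
          congr 2
          field_simp
        · refine lintegral_congr fun s => ?_
          rw [← ENNReal.rpow_mul]
          congr 1
          field_simp
    have h2 := lintegral_Ioi_measure_rpow_neg_le lam (hlamt t ht) hlam0' hi0
      (by linarith : 1 / Q < 1)
    rw [e1, e2] at h2
    have h3 : lam (Ioi t) ^ (1 / Q') ≤ B * ν (Iio t) ^ (-(1 / Q)) := by
      rw [ENNReal.rpow_neg, ← div_eq_mul_inv, ENNReal.le_div_iff_mul_le, mul_comm]
      · exact hB t ht
      · exact Or.inl (by simp [hν0 t ht, hνt t ht])
      · exact Or.inl (ENNReal.rpow_ne_top_of_nonneg hi0.le (hνt t ht))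
    calc (∫⁻ s in Ioi t, k s ∂lam) ^ Q
        ≤ ((∫⁻ s in Ioi t, k s ^ Q * lam (Ioi s) ^ (1 / Q') ∂lam) ^ (1 / Q) *
          (ENNReal.ofReal Q' * (B * ν (Iio t) ^ (-(1 / Q)))) ^ (1 / Q')) ^ Q := by
          gcongr
          exact h1.trans (by gcongr; exact h2.trans (by gcongr))
      _ = _ := by
          rw [ENNReal.mul_rpow_of_nonneg _ _ hQ0.le, ← ENNReal.rpow_mul, ← ENNReal.rpow_mul,
            one_div_mul_cancel hne, ENNReal.rpow_one, ← mul_assoc (ENNReal.ofReal Q'),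
            ENNReal.mul_rpow_of_nonneg _ _ (by positivity), ← ENNReal.rpow_mul]
          rw [show 1 / Q' * Q = Q / Q' by ring, show -(1 / Q) * (Q / Q') = -(1 / Q') by field_simp]
          ring
  have hK : Measurable fun s => k s ^ Q * lam (Ioi s) ^ (1 / Q') :=
    (hk.pow_const _).mul (hVm.pow_const _)
  calc ∫⁻ t, (∫⁻ s in Ioi t, k s ∂lam) ^ Q ∂ν
      ≤ ∫⁻ t, (ENNReal.ofReal Q' * B) ^ (Q / Q') * (ν (Iio t) ^ (-(1 / Q')) *
        ∫⁻ s in Ioi t, k s ^ Q * lam (Ioi s) ^ (1 / Q') ∂lam) ∂ν :=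
        lintegral_mono_ae (hνpos.mono pt)
    _ = (ENNReal.ofReal Q' * B) ^ (Q / Q') * ∫⁻ t, (ν (Iio t) ^ (-(1 / Q')) *
        ∫⁻ s in Ioi t, k s ^ Q * lam (Ioi s) ^ (1 / Q') ∂lam) ∂ν := by
        refine lintegral_const_mul _ ((hWm.pow_const _).mul ?_)
        exact Antitone.measurable fun a b h => lintegral_mono_set (Ioi_subset_Ioi h)
    _ = (ENNReal.ofReal Q' * B) ^ (Q / Q') * ∫⁻ s, k s ^ Q * lam (Ioi s) ^ (1 / Q') *
        ∫⁻ t in Iio s, ν (Iio t) ^ (-(1 / Q')) ∂ν ∂lam := by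
        congr 1
        have hS : MeasurableSet {p : ℝ × ℝ | p.1 < p.2} :=
          measurableSet_lt measurable_fst measurable_snd
        have hmeas : Measurable (Function.uncurry fun t s : ℝ =>
            {p : ℝ × ℝ | p.1 < p.2}.indicator (fun p => ν (Iio p.1) ^ (-(1 / Q')) *
              (k p.2 ^ Q * lam (Ioi p.2) ^ (1 / Q'))) (t, s)) :=
          (((hWm.pow_const _).comp measurable_fst).mul (hK.comp measurable_snd)).indicator hS
        calc _ = ∫⁻ t, ∫⁻ s, {p : ℝ × ℝ | p.1 < p.2}.indicator (fun p =>
                ν (Iio p.1) ^ (-(1 / Q')) * (k p.2 ^ Q * lam (Ioi p.2) ^ (1 / Q'))) (t, s)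
                ∂lam ∂ν := by
              refine lintegral_congr fun t => ?_
              rw [← lintegral_const_mul _ hK, ← lintegral_indicator measurableSet_Ioi]
              rfl
          _ = _ := by
              rw [lintegral_lintegral_swap hmeas.aemeasurable]
              refine lintegral_congr fun s => ?_
              rw [← lintegral_const_mul _ (hWm.pow_const _), ← lintegral_indicator measurableSet_Iio]
              refine lintegral_congr fun t => ?_
              simp only [indicator, mem_ofPred_eq, mem_Iio]
              split_ifs <;> ring
    _ ≤ (ENNReal.ofReal Q' * B) ^ (Q / Q') * ∫⁻ s, ENNReal.ofReal Q * B * k s ^ Q ∂lam := by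
        refine mul_le_mul' le_rfl (lintegral_mono_ae (hlampos.mono fun s hs => ?_))
        have h2 := lintegral_Iio_measure_rpow_neg_le ν (hνt s hs) hν0' hi0'
          (by linarith : 1 / Q' < 1)
        rw [e1', e2'] at h2
        calc _ ≤ k s ^ Q * lam (Ioi s) ^ (1 / Q') * (ENNReal.ofReal Q * ν (Iio s) ^ (1 / Q)) := by
              gcongr
          _ = ENNReal.ofReal Q * (ν (Iio s) ^ (1 / Q) * lam (Ioi s) ^ (1 / Q')) * k s ^ Q := by
              ring
          _ ≤ _ := by
              gcongr
              exact hB s hs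
    _ = _ := by
        rw [lintegral_const_mul _ (hk.pow_const _)]
        ring

/-- The converse of Hölder's inequality. -/
theorem lintegral_rpow_le_of_forall_lintegral_mul_le {Y : Type*} [MeasurableSpace Y]
    (lam : Measure Y) [SigmaFinite lam] {Q Q' : ℝ} (hQ : Q.HolderConjugate Q') {F : Y → ℝ≥0∞}
    {K : ℝ≥0∞}
    (hK : ∀ k : Y → ℝ≥0∞, Measurable k → ∫⁻ y, k y ^ Q ∂lam ≤ 1 → ∫⁻ y, F y * k y ∂lam ≤ K) :
    (∫⁻ y, F y ^ Q' ∂lam) ^ (1 / Q') ≤ K := by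
  have hQ0 := hQ.pos
  have hQ'0 := hQ.symm.pos
  have hsum : 1 / Q + 1 / Q' = 1 := by simpa using hQ.inv_add_inv_eq_one
  rw [one_div, ENNReal.rpow_inv_le_iff hQ'0]
  refine le_of_forall_lt fun L hL => ?_
  rw [lintegral_eq_nnreal] at hL
  simp_rw [lt_iSup_iff] at hL
  obtain ⟨g₀, hg₀, hL⟩ := hL
  rw [← SimpleFunc.lintegral_eq_lintegral] at hL
  obtain ⟨g, hg, gfin, hLg⟩ := SimpleFunc.exists_lt_lintegral_simpleFunc_of_lt_lintegral
    (f := g₀) (μ := lam) (L := L) (by simpa using hL)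
  refine hLg.trans_le ?_
  set I : ℝ≥0∞ := ∫⁻ x, g x ∂lam with hI
  have hI0 : I ≠ 0 := (bot_le.trans_lt hLg).ne'
  have hm : Measurable fun y => (g y : ℝ≥0∞) := g.measurable.coe_nnreal_ennreal
  have hIi : I ^ (-(1 / Q)) ≠ ∞ := by
    simp [ENNReal.rpow_eq_top_iff, hI0, gfin.ne]
  have h := hK (fun y => I ^ (-(1 / Q)) * (g y : ℝ≥0∞) ^ (1 / Q))
    ((hm.pow_const _).const_mul _) (by
      simp_rw [ENNReal.mul_rpow_of_nonneg _ _ hQ0.le, ← ENNReal.rpow_mul]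
      rw [neg_mul, one_div_mul_cancel hQ0.ne']
      simp_rw [ENNReal.rpow_one]
      rw [lintegral_const_mul _ hm, ENNReal.rpow_neg_one]
      exact (ENNReal.inv_mul_cancel hI0 gfin.ne).le)
  have h' : I ^ (1 / Q') ≤ K := by
    refine le_trans (le_trans (le_of_eq ?_) (lintegral_mono (f := fun y =>
      I ^ (-(1 / Q)) * (g y : ℝ≥0∞)) fun y => ?_)) h
    · rw [lintegral_const_mul _ hm, ← hI]
      nth_rewrite 3 [← ENNReal.rpow_one I]
      rw [← ENNReal.rpow_add _ _ hI0 gfin.ne]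
      congr 1
      linarith
    · have : (g y : ℝ≥0∞) ^ (1 / Q') ≤ F y := by
        rw [one_div, ENNReal.rpow_inv_le_iff hQ'0]
        exact (ENNReal.coe_le_coe.2 (hg y)).trans (hg₀ y)
      calc I ^ (-(1 / Q)) * (g y : ℝ≥0∞)
          = (g y : ℝ≥0∞) ^ (1 / Q') * (I ^ (-(1 / Q)) * (g y : ℝ≥0∞) ^ (1 / Q)) := by
            rw [mul_left_comm, ← ENNReal.rpow_add_of_nonneg _ _ (by positivity) (by positivity),
              add_comm, hsum, ENNReal.rpow_one]
        _ ≤ _ := by gcongr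
  rwa [one_div, ENNReal.rpow_inv_le_iff hQ'0] at h'

section Rearrangement

variable {X : Type*} [MeasurableSpace X] {μ : Measure X}

theorem lt_rearr_iff {f : X → ℝ} {s : ℝ≥0∞} {t : ℝ} :
    s < rearr μ f t ↔ ENNReal.ofReal t < μ {x | s < ENNReal.ofReal |f x|} := by
  constructor
  · intro h
    by_contra! hle
    exact absurd (sInf_le (show s ∈ {s | μ {x | s < ENNReal.ofReal |f x|} ≤ ENNReal.ofReal t}
      from hle)) (not_le.2 h)
  · intro h
    by_contra! hle
    have hmeas : ∀ s' > s, μ {x | s' < ENNReal.ofReal |f x|} ≤ ENNReal.ofReal t := by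
      intro s' hs'
      obtain ⟨r, hr, hrs⟩ := sInf_lt_iff.1 (hle.trans_lt hs')
      exact (measure_mono fun x hx => hrs.trans hx).trans hr
    have hst : s ≠ ∞ := by
      rintro rfl
      simp at h
    obtain ⟨u, hu, hus, hulim⟩ := exists_seq_strictAnti_tendsto' (lt_top_iff_ne_top.2 hst)
    have hU : {x | s < ENNReal.ofReal |f x|} = ⋃ n, {x | u n < ENNReal.ofReal |f x|} := by
      ext x
      simp only [mem_iUnion, mem_ofPred_eq]
      constructor
      · intro hx
        exact (hulim.eventually_lt_const hx).exists
      · rintro ⟨n, hn⟩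
        exact (hus n).1.trans hn
    rw [hU, Directed.measure_iUnion] at h
    · exact absurd h (not_lt.2 (iSup_le fun n => hmeas _ (hus n).1))
    · exact Monotone.directed_le fun m n hmn x hx =>
        lt_of_le_of_lt (hu.antitone hmn) hx

theorem rearr_le_iff {f : X → ℝ} {s : ℝ≥0∞} {t : ℝ} :
    rearr μ f t ≤ s ↔ μ {x | s < ENNReal.ofReal |f x|} ≤ ENNReal.ofReal t := by
  rw [← not_lt, lt_rearr_iff, not_lt]

theorem rearr_antitone (f : X → ℝ) : Antitone (rearr μ f) := fun _ _ h =>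
  sInf_le_sInf fun _ hs => le_trans hs (ENNReal.ofReal_le_ofReal h)

theorem measurable_rearr (f : X → ℝ) : Measurable (rearr μ f) :=
  (rearr_antitone f).measurable

theorem volume_setOf_ofReal_lt (a : ℝ≥0∞) :
    volume ({s : ℝ | ENNReal.ofReal s < a} ∩ Ioi 0) = a := by
  rcases eq_or_ne a ∞ with rfl | ha
  · simp [ENNReal.ofReal_lt_top]
  · have : {s : ℝ | ENNReal.ofReal s < a} ∩ Ioi 0 = Ioo 0 a.toReal := by
      ext s
      simp only [mem_inter_iff, mem_ofPred_eq, mem_Ioi, mem_Ioo]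
      constructor
      · rintro ⟨h1, h2⟩
        exact ⟨h2, (ENNReal.ofReal_lt_iff_lt_toReal h2.le ha).1 h1⟩
      · rintro ⟨h1, h2⟩
        exact ⟨(ENNReal.ofReal_lt_iff_lt_toReal h1.le ha).2 h2, h1⟩
    rw [this, Real.volume_Ioo, sub_zero, ENNReal.ofReal_toReal ha]

/-- The layer-cake formula for `ℝ≥0∞`-valued functions. -/
theorem lintegral_eq_lintegral_measure_ofReal_lt {Y : Type*} [MeasurableSpace Y] (ν : Measure Y)
    [SFinite ν] {u : Y → ℝ≥0∞} (hu : Measurable u) :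
    ∫⁻ y, u y ∂ν = ∫⁻ s in Ioi (0 : ℝ), ν {y | ENNReal.ofReal s < u y} := by
  have hS : MeasurableSet {p : Y × ℝ | ENNReal.ofReal p.2 < u p.1} :=
    measurableSet_lt (ENNReal.measurable_ofReal.comp measurable_snd) (hu.comp measurable_fst)
  have hmeas : Measurable (Function.uncurry fun (y : Y) (s : ℝ) =>
      {p : Y × ℝ | ENNReal.ofReal p.2 < u p.1}.indicator (fun _ => (1 : ℝ≥0∞)) (y, s)) :=
    measurable_const.indicator hS
  calc ∫⁻ y, u y ∂ν = ∫⁻ y, ∫⁻ s in Ioi (0 : ℝ),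
        {p : Y × ℝ | ENNReal.ofReal p.2 < u p.1}.indicator (fun _ => (1 : ℝ≥0∞)) (y, s) ∂volume ∂ν := by
        refine lintegral_congr fun y => ?_
        have hT : MeasurableSet {s : ℝ | ENNReal.ofReal s < u y} :=
          measurableSet_lt ENNReal.measurable_ofReal measurable_const
        have := lintegral_indicator_one (μ := volume.restrict (Ioi (0 : ℝ))) hT
        rw [Measure.restrict_apply hT, volume_setOf_ofReal_lt] at this
        exact this.symm
    _ = _ := by
        rw [lintegral_lintegral_swap hmeas.aemeasurable]
        refine lintegral_congr fun s => ?_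
        have hT : MeasurableSet {y | ENNReal.ofReal s < u y} :=
          measurableSet_lt measurable_const hu
        exact lintegral_indicator_one hT

theorem lintegral_mul_eq_lintegral_measure_ofReal_lt {Y : Type*} [MeasurableSpace Y]
    (ν : Measure Y) [SFinite ν] {u v : Y → ℝ≥0∞} (hu : Measurable u) (hv : Measurable v) :
    ∫⁻ y, u y * v y ∂ν = ∫⁻ r in Ioi (0 : ℝ), ∫⁻ s in Ioi (0 : ℝ),
      ν ({y | ENNReal.ofReal s < u y} ∩ {y | ENNReal.ofReal r < v y}) := by
  have h1 := lintegral_eq_lintegral_measure_ofReal_lt (ν.withDensity u) hv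
  rw [lintegral_withDensity_eq_lintegral_mul _ hu hv] at h1
  refine h1.trans (lintegral_congr fun r => ?_)
  have hR : MeasurableSet {y | ENNReal.ofReal r < v y} := measurableSet_lt measurable_const hv
  rw [withDensity_apply _ hR, lintegral_eq_lintegral_measure_ofReal_lt _ hu]
  refine lintegral_congr fun s => ?_
  rw [Measure.restrict_apply (measurableSet_lt measurable_const hu)]

/-- The Hardy–Littlewood rearrangement inequality. -/
theorem lintegral_abs_mul_le_lintegral_rearr_mul [SFinite μ] {f g : X → ℝ} (hf : Measurable f)
    (hg : Measurable g) :
    ∫⁻ x, ENNReal.ofReal |f x * g x| ∂μ ≤ ∫⁻ t in Ioi (0 : ℝ), rearr μ f t * rearr μ g t := by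
  have hf' : Measurable fun x => ENNReal.ofReal |f x| := ENNReal.measurable_ofReal.comp
    (measurable_norm.comp hf)
  have hg' : Measurable fun x => ENNReal.ofReal |g x| := ENNReal.measurable_ofReal.comp
    (measurable_norm.comp hg)
  simp_rw [abs_mul, ENNReal.ofReal_mul (abs_nonneg _)]
  rw [lintegral_mul_eq_lintegral_measure_ofReal_lt _ hf' hg',
    lintegral_mul_eq_lintegral_measure_ofReal_lt _ (measurable_rearr f) (measurable_rearr g)]
  refine lintegral_mono fun r => lintegral_mono fun s => ?_
  have hS : MeasurableSet ({y | ENNReal.ofReal s < rearr μ f y} ∩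
      {y | ENNReal.ofReal r < rearr μ g y}) :=
    (measurableSet_lt measurable_const (measurable_rearr f)).inter
      (measurableSet_lt measurable_const (measurable_rearr g))
  rw [Measure.restrict_apply hS]
  have : {y | ENNReal.ofReal s < rearr μ f y} ∩ {y | ENNReal.ofReal r < rearr μ g y} =
      {t : ℝ | ENNReal.ofReal t < min (μ {x | ENNReal.ofReal s < ENNReal.ofReal |f x|})
        (μ {x | ENNReal.ofReal r < ENNReal.ofReal |g x|})} := by
    ext t
    simp only [mem_inter_iff, mem_ofPred_eq, lt_rearr_iff, lt_min_iff]
  rw [this, volume_setOf_ofReal_lt]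
  exact le_min (measure_mono inter_subset_left) (measure_mono inter_subset_right)

theorem rearr_le_maxf (f : X → ℝ) {t : ℝ} (ht : 0 < t) : rearr μ f t ≤ maxf μ f t := by
  have h : rearr μ f t * ENNReal.ofReal t ≤ ∫⁻ s in Ioo (0 : ℝ) t, rearr μ f s := by
    calc rearr μ f t * ENNReal.ofReal t = ∫⁻ _ in Ioo (0 : ℝ) t, rearr μ f t := by simp
      _ ≤ _ := setLIntegral_mono' measurableSet_Ioo fun s hs => rearr_antitone f hs.2.le
  have ht0 : ENNReal.ofReal t ≠ 0 := by simpa using ht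
  rw [maxf, mul_comm, ← div_eq_mul_inv, ENNReal.le_div_iff_mul_le (Or.inl ht0)
    (Or.inl ENNReal.ofReal_ne_top)]
  exact h

end Rearrangement

section Nonatomic

variable {X : Type*} [MeasurableSpace X] {μ : Measure X}

theorem IsNonatomic.exists_subset_measure_pos_le (hna : IsNonatomic μ) {S : Set X}
    (hS : MeasurableSet S) (hpos : 0 < μ S) {ε : ℝ≥0∞} (hε : ε ≠ 0) :
    ∃ T ⊆ S, MeasurableSet T ∧ 0 < μ T ∧ μ T ≤ ε := by
  obtain ⟨T₀, hT₀S, hT₀, hT₀pos, hT₀lt⟩ := hna S hS hpos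
  have hT₀t : μ T₀ ≠ ∞ := hT₀lt.ne_top
  have key : ∀ n : ℕ, ∃ T ⊆ S, MeasurableSet T ∧ 0 < μ T ∧ μ T ≤ 2⁻¹ ^ n * μ T₀ := by
    intro n
    induction n with
    | zero => exact ⟨T₀, hT₀S, hT₀, hT₀pos, by simp⟩
    | succ n ih =>
      obtain ⟨T, hTS, hT, hTpos, hTle⟩ := ih
      obtain ⟨T', hT'T, hT', hT'pos, hT'lt⟩ := hna T hT hTpos
      have hTsum : μ (T \ T') + μ T' = μ T := by
        rw [add_comm, ← measure_inter_add_sdiff T hT', inter_eq_self_of_subset_right hT'T]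
      have hhalf : 2⁻¹ ^ (n + 1) * μ T₀ = (2⁻¹ ^ n * μ T₀) / 2 := by
        rw [pow_succ, div_eq_mul_inv]; ring
      rw [hhalf]
      have hcases : μ T' ≤ μ T / 2 ∨ μ (T \ T') ≤ μ T / 2 := by
        by_contra! h
        have := ENNReal.add_lt_add h.2 h.1
        rw [ENNReal.add_halves, hTsum] at this
        exact lt_irrefl _ this
      rcases hcases with h | h
      · exact ⟨T', hT'T.trans hTS, hT', hT'pos, h.trans (by gcongr)⟩
      · refine ⟨T \ T', sdiff_subset.trans hTS, hT.diff hT', ?_, h.trans (by gcongr)⟩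
        rw [pos_iff_ne_zero]
        intro h0
        rw [h0, zero_add] at hTsum
        exact hT'lt.ne hTsum
  obtain ⟨n, hn⟩ := ENNReal.exists_inv_two_pow_lt (ENNReal.div_pos hε hT₀t).ne'
  obtain ⟨T, hTS, hT, hTpos, hTle⟩ := key n
  refine ⟨T, hTS, hT, hTpos, hTle.trans ?_⟩
  exact ENNReal.mul_le_of_le_div hn.le

/-- A non-atomic measure attains every intermediate value on subsets. -/
theorem IsNonatomic.exists_subset_measure_eq (hna : IsNonatomic μ) {S : Set X}
    (hS : MeasurableSet S) {t : ℝ≥0∞} (ht : t ≠ ∞) (htS : t ≤ μ S) :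
    ∃ A ⊆ S, MeasurableSet A ∧ μ A = t := by
  let P : Set (Set X) := {A | A ⊆ S ∧ MeasurableSet A ∧ μ A ≤ t}
  have step : ∀ (n : ℕ) (A : P), ∃ B : P, A.1 ⊆ B.1 ∧
      ∀ C ∈ P, A.1 ⊆ C → μ C ≤ μ B.1 + 2⁻¹ ^ n := by
    intro n A
    let c : ℝ≥0∞ := ⨆ C : {C : P // A.1 ⊆ C.1}, μ C.1.1
    have hct : c ≠ ∞ := ((iSup_le fun C => C.1.2.2.2).trans_lt ht.lt_top).ne
    have hn : (2⁻¹ : ℝ≥0∞) ^ n ≠ 0 := by simp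
    obtain ⟨B, hB⟩ : ∃ B : {C : P // A.1 ⊆ C.1}, c ≤ μ B.1.1 + 2⁻¹ ^ n := by
      rcases eq_or_ne c 0 with h0 | h0
      · exact ⟨⟨A, subset_rfl⟩, h0.trans_le zero_le⟩
      · obtain ⟨B, hB⟩ := lt_iSup_iff.1 (ENNReal.sub_lt_self hct h0 hn)
        exact ⟨B, tsub_le_iff_right.1 hB.le⟩
    exact ⟨B.1, B.2, fun C hC hAC => (le_iSup (fun C : {C : P // A.1 ⊆ C.1} => μ C.1.1)
      ⟨⟨C, hC⟩, hAC⟩).trans hB⟩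
  choose next hsub hnext using step
  let A : ℕ → P := fun n => Nat.rec ⟨∅, by simp, by simp, by simp⟩ (fun n B => next n B) n
  have hmono : Monotone fun n => (A n).1 := monotone_nat_of_le_succ fun n => hsub n (A n)
  have hUS : ⋃ n, (A n).1 ⊆ S := iUnion_subset fun n => (A n).2.1
  have hUm : MeasurableSet (⋃ n, (A n).1) := MeasurableSet.iUnion fun n => (A n).2.2.1
  have hUt : μ (⋃ n, (A n).1) ≤ t := by
    rw [Directed.measure_iUnion hmono.directed_le]
    exact iSup_le fun n => (A n).2.2.2
  refine ⟨_, hUS, hUm, hUt.antisymm ?_⟩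
  by_contra! hlt
  have hdiff : 0 < μ (S \ ⋃ n, (A n).1) :=
    (tsub_pos_of_lt (hlt.trans_le htS)).trans_le le_measure_sdiff
  obtain ⟨T, hTS, hT, hTpos, hTle⟩ := hna.exists_subset_measure_pos_le (hS.diff hUm) hdiff
    (tsub_pos_of_lt hlt).ne'
  have hdisj : Disjoint (⋃ n, (A n).1) T :=
    disjoint_left.2 fun x hx hxT => (hTS hxT).2 hx
  have hCm : μ ((⋃ n, (A n).1) ∪ T) = μ (⋃ n, (A n).1) + μ T := measure_union hdisj hT
  have hC : (⋃ n, (A n).1) ∪ T ∈ P := by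
    refine ⟨union_subset hUS (hTS.trans sdiff_subset), hUm.union hT, ?_⟩
    rw [hCm]
    exact (add_le_add_right hTle _).trans (add_tsub_cancel_of_le hlt.le).le
  obtain ⟨n, hn⟩ := ENNReal.exists_inv_two_pow_lt hTpos.ne'
  have h1 := hnext n (A n) _ hC ((subset_iUnion (fun n => (A n).1) n).trans subset_union_left)
  have h2 : μ (next n (A n)).1 ≤ μ (⋃ n, (A n).1) :=
    measure_mono (subset_iUnion (fun n => (A n).1) (n + 1))
  rw [hCm] at h1
  have h3 := h1.trans (add_le_add_left h2 _)
  rw [ENNReal.add_le_add_iff_left (hlt.ne_top)] at h3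
  exact absurd h3 (not_le.2 hn)

end Nonatomic

section Realization

variable {X : Type*} [MeasurableSpace X] {μ : Measure X}

/-- A non-negative step function adapted to superlevel sets of `f` of measure `2 ^ k * δ`. -/
theorem IsNonatomic.exists_step_function (hna : IsNonatomic μ) {f : X → ℝ} (hf : Measurable f)
    {δ : ℝ} (hδ : 0 < δ) (c : ℕ → NNReal) (s : ℕ → ℝ≥0∞)
    (hs : ∀ k, s k = 0 ∨ s k < rearr μ f (δ * 2 ^ (k + 1))) (n : ℕ) :
    ∃ (g : X → ℝ) (U : Set X), Measurable g ∧ MeasurableSet U ∧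
      μ U ≤ ENNReal.ofReal (δ * 2 ^ n) ∧ (∀ x ∉ U, g x = 0) ∧
      ∑ k ∈ Finset.range n, c k * s k * ENNReal.ofReal (δ * 2 ^ k) ≤
        ∫⁻ x in U, ENNReal.ofReal |f x * g x| ∂μ ∧
      ∀ a : ℝ≥0∞, μ {x | a < ENNReal.ofReal |g x|} ≤
        ∑ k ∈ Finset.range n, if a < c k then ENNReal.ofReal (δ * 2 ^ k) else 0 := by
  induction n with
  | zero => exact ⟨0, ∅, measurable_zero, by simp, by simp, by simp, by simp, by simp⟩
  | succ n ih =>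
    obtain ⟨g, U, hg, hU, hUle, hgU, hsum, hdist⟩ := ih
    have hfm : Measurable fun x => ENNReal.ofReal |f x| :=
      ENNReal.measurable_ofReal.comp (measurable_norm.comp hf)
    obtain ⟨B, hBm, hBU, hBle, hBint⟩ : ∃ B : Set X, MeasurableSet B ∧ Disjoint U B ∧
        μ B ≤ ENNReal.ofReal (δ * 2 ^ n) ∧
        s n * ENNReal.ofReal (δ * 2 ^ n) ≤ ∫⁻ x in B, ENNReal.ofReal |f x| ∂μ := by
      rcases hs n with h0 | hlt
      · exact ⟨∅, by simp, by simp, by simp, by simp [h0]⟩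
      have hSm : MeasurableSet {x | s n < ENNReal.ofReal |f x|} :=
        measurableSet_lt measurable_const hfm
      have hSU : ENNReal.ofReal (δ * 2 ^ n) ≤ μ ({x | s n < ENNReal.ofReal |f x|} \ U) := by
        have h1 := (lt_rearr_iff.1 hlt).le.trans (tsub_le_iff_right.1
          (le_measure_sdiff (μ := μ) (s₁ := {x | s n < ENNReal.ofReal |f x|}) (s₂ := U)))
        have h2 := h1.trans (add_le_add_right hUle _)
        rw [show δ * 2 ^ (n + 1) = δ * 2 ^ n + δ * 2 ^ n by ring,
          ENNReal.ofReal_add (by positivity) (by positivity),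
          ENNReal.add_le_add_iff_right ENNReal.ofReal_ne_top] at h2
        exact h2
      obtain ⟨B, hBS, hB, hBeq⟩ := hna.exists_subset_measure_eq (hSm.diff hU)
        ENNReal.ofReal_ne_top hSU
      refine ⟨B, hB, disjoint_left.2 fun x hx hxB => (hBS hxB).2 hx, hBeq.le, ?_⟩
      rw [← hBeq, ← setLIntegral_const]
      exact setLIntegral_mono' hB fun x hx => le_of_lt (hBS hx).1
    have hon : ∀ x ∈ B, g x + B.indicator (fun _ => (c n : ℝ)) x = c n := by
      intro x hx
      rw [hgU x (disjoint_right.1 hBU hx), indicator_of_mem hx, zero_add]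
    have hoff : ∀ x ∉ B, g x + B.indicator (fun _ => (c n : ℝ)) x = g x := by
      intro x hx
      rw [indicator_of_notMem hx, add_zero]
    refine ⟨fun x => g x + B.indicator (fun _ => (c n : ℝ)) x, U ∪ B,
      hg.add (measurable_const.indicator hBm), hU.union hBm, ?_, ?_, ?_, ?_⟩
    · rw [show δ * 2 ^ (n + 1) = δ * 2 ^ n + δ * 2 ^ n by ring,
        ENNReal.ofReal_add (by positivity) (by positivity)]
      exact (measure_union_le _ _).trans (add_le_add hUle hBle)
    · intro x hx
      simp only [mem_union, not_or] at hx
      exact (hoff x hx.2).trans (hgU x hx.1)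
    · rw [Finset.sum_range_succ, lintegral_union hBm hBU]
      refine add_le_add (hsum.trans (le_of_eq (setLIntegral_congr_fun hU fun x hx => ?_))) ?_
      · simp only [hoff x (disjoint_left.1 hBU hx)]
      · rw [mul_assoc]
        refine (mul_le_mul' le_rfl hBint).trans ?_
        rw [← lintegral_const_mul _ hfm]
        refine le_of_eq (setLIntegral_congr_fun hBm fun x hx => ?_)
        simp only [hon x hx]
        rw [abs_mul, ENNReal.ofReal_mul (abs_nonneg _), mul_comm]
        simp
    · intro a
      rw [Finset.sum_range_succ]
      by_cases ha : a < c n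
      · rw [if_pos ha]
        refine (measure_mono (t := {x | a < ENNReal.ofReal |g x|} ∪ B) fun x hx => ?_).trans
          ((measure_union_le _ _).trans (add_le_add (hdist a) hBle))
        by_cases hxB : x ∈ B
        · exact Or.inr hxB
        · left
          simpa only [mem_ofPred_eq, hoff x hxB] using hx
      · rw [if_neg ha, add_zero]
        refine (measure_mono fun x hx => ?_).trans (hdist a)
        by_cases hxB : x ∈ B
        · exfalso
          simp only [mem_ofPred_eq, hon x hxB] at hx
          exact ha (by simpa using hx)
        · simpa only [mem_ofPred_eq, hoff x hxB] using hx

theorem sum_ite_two_pow_le {δ t : ℝ} (hδ : 0 < δ) (ht : 0 < t) (n : ℕ) :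
    (∑ k ∈ Finset.range n, if δ * 2 ^ (k + 1) < t then ENNReal.ofReal (δ * 2 ^ k) else 0) ≤
      ENNReal.ofReal t := by
  suffices h : (∑ k ∈ Finset.range n, if δ * 2 ^ (k + 1) < t then δ * 2 ^ k else 0) ≤
      min t (δ * 2 ^ n) by
    refine le_trans (le_of_eq ?_) (ENNReal.ofReal_le_ofReal (h.trans (min_le_left _ _)))
    rw [ENNReal.ofReal_sum_of_nonneg fun k _ => by split_ifs <;> positivity]
    refine Finset.sum_congr rfl fun k _ => ?_
    split_ifs <;> simp
  induction n with
  | zero => simp [ht.le, hδ.le]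
  | succ n ih =>
    have h2 : δ * 2 ^ (n + 1) = δ * 2 ^ n + δ * 2 ^ n := by ring
    have hp : 0 < δ * 2 ^ n := by positivity
    have h1 := ih.trans (min_le_left _ _)
    have h3 := ih.trans (min_le_right _ _)
    rw [Finset.sum_range_succ]
    split_ifs with h
    · exact le_min (by linarith) (by linarith)
    · exact le_min (by linarith) (by linarith)

theorem tendsto_min_natCast (a : ℝ≥0∞) :
    Tendsto (fun N : ℕ => min a N) atTop (𝓝 a) := by
  simpa using (tendsto_const_nhds (x := a)).min ENNReal.tendsto_nat_nhds_top

/-- On a non-atomic measure space, `∫ f* G` is controlled by the integrals `∫ |f g|`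
with `g* ≤ G`. -/
theorem IsNonatomic.lintegral_rearr_mul_le (hna : IsNonatomic μ) {f : X → ℝ} (hf : Measurable f)
    {G : ℝ → ℝ≥0∞} (hG : AntitoneOn G (Ioi 0)) {K : ℝ≥0∞}
    (hK : ∀ g : X → ℝ, Measurable g → (∀ t > 0, rearr μ g t ≤ G t) →
      ∫⁻ x, ENNReal.ofReal |f x * g x| ∂μ ≤ K) :
    ∫⁻ t in Ioi (0 : ℝ), rearr μ f t * G t ≤ 4 * K := by
  have hsum : ∀ (δ : ℝ), 0 < δ → ∀ n N : ℕ,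
      ∑ k ∈ Finset.range n, min (G (δ * 2 ^ (k + 1))) N *
        (min (rearr μ f (δ * 2 ^ (k + 1))) N / 2) * ENNReal.ofReal (δ * 2 ^ k) ≤ K := by
    intro δ hδ n N
    have hc : ∀ k, ((min (G (δ * 2 ^ (k + 1))) N).toNNReal : ℝ≥0∞) =
        min (G (δ * 2 ^ (k + 1))) N := fun k =>
      ENNReal.coe_toNNReal ((min_le_right _ _).trans_lt (ENNReal.natCast_lt_top N)).ne
    obtain ⟨g, U, hg, -, -, -, hsum, hdist⟩ := hna.exists_step_function hf hδ
      (fun k => (min (G (δ * 2 ^ (k + 1))) N).toNNReal)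
      (fun k => min (rearr μ f (δ * 2 ^ (k + 1))) N / 2) (fun k => by
        rcases eq_or_ne (min (rearr μ f (δ * 2 ^ (k + 1))) N) 0 with h | h
        · left; simp [h]
        · right
          exact (ENNReal.half_lt_self h ((min_le_right _ _).trans_lt
            (ENNReal.natCast_lt_top N)).ne).trans_le (min_le_left _ _)) n
    simp only [hc] at hsum hdist
    refine (hsum.trans (setLIntegral_le_lintegral _ _)).trans (hK g hg fun t ht => ?_)
    rw [rearr_le_iff]
    refine (hdist (G t)).trans (le_trans (Finset.sum_le_sum fun k _ => ?_)
      (sum_ite_two_pow_le hδ ht n))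
    by_cases h : G t < min (G (δ * 2 ^ (k + 1))) N
    · rw [if_pos h, if_pos]
      by_contra! hle
      exact absurd (hG ht (mem_Ioi.2 (by positivity)) hle)
        (not_le.2 (h.trans_le (min_le_left _ _)))
    · rw [if_neg h]
      exact zero_le
  have hlim : ∀ (δ : ℝ), 0 < δ → ∀ n : ℕ,
      ∑ k ∈ Finset.range n, G (δ * 2 ^ (k + 1)) *
        (rearr μ f (δ * 2 ^ (k + 1)) / 2) * ENNReal.ofReal (δ * 2 ^ k) ≤ K := by
    intro δ hδ n
    refine le_of_tendsto' (x := atTop) (tendsto_finsetSum _ fun k _ => ?_) (hsum δ hδ n)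
    refine ENNReal.Tendsto.mul_const ?_ (Or.inr ENNReal.ofReal_ne_top)
    rcases eq_or_ne (G (δ * 2 ^ (k + 1))) 0 with h0 | h0
    · simp [h0]
    rcases eq_or_ne (rearr μ f (δ * 2 ^ (k + 1))) 0 with h1 | h1
    · simp [h1]
    refine ENNReal.Tendsto.mul (tendsto_min_natCast _) (Or.inl h0) ?_ (Or.inl ?_)
    · exact ENNReal.Tendsto.div_const (tendsto_min_natCast _) (Or.inl h1)
    · simpa using h1
  have hint : ∀ (δ : ℝ), 0 < δ → ∀ n : ℕ,
      ∫⁻ t in Ico (δ * 2) (δ * 2 ^ (n + 1)), rearr μ f t * G t ≤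
      4 * ∑ k ∈ Finset.range n, G (δ * 2 ^ (k + 1)) *
        (rearr μ f (δ * 2 ^ (k + 1)) / 2) * ENNReal.ofReal (δ * 2 ^ k) := by
    intro δ hδ n
    induction n with
    | zero => simp
    | succ n ih =>
      have h1 : (1 : ℝ) ≤ 2 ^ n := one_le_pow₀ (by norm_num)
      have hsplit : Ico (δ * 2) (δ * 2 ^ (n + 1 + 1)) =
          Ico (δ * 2) (δ * 2 ^ (n + 1)) ∪ Ico (δ * 2 ^ (n + 1)) (δ * 2 ^ (n + 1 + 1)) := by
        rw [Ico_union_Ico_eq_Ico]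
        · rw [pow_succ]; nlinarith
        · rw [pow_succ _ (n + 1), pow_succ]; nlinarith
      rw [hsplit, Finset.sum_range_succ, mul_add]
      refine (lintegral_union_le _ _ _).trans (add_le_add ih ?_)
      have hpos : 0 < δ * 2 ^ (n + 1) := by positivity
      calc ∫⁻ t in Ico (δ * 2 ^ (n + 1)) (δ * 2 ^ (n + 1 + 1)), rearr μ f t * G t
          ≤ ∫⁻ _ in Ico (δ * 2 ^ (n + 1)) (δ * 2 ^ (n + 1 + 1)),
            rearr μ f (δ * 2 ^ (n + 1)) * G (δ * 2 ^ (n + 1)) :=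
            setLIntegral_mono' measurableSet_Ico fun t ht =>
              mul_le_mul' (rearr_antitone f ht.1) (hG hpos (hpos.trans_le ht.1) ht.1)
        _ = rearr μ f (δ * 2 ^ (n + 1)) * G (δ * 2 ^ (n + 1)) *
            (2 * ENNReal.ofReal (δ * 2 ^ n)) := by
            rw [setLIntegral_const, Real.volume_Ico,
              show δ * 2 ^ (n + 1 + 1) - δ * 2 ^ (n + 1) = 2 * (δ * 2 ^ n) by ring,
              ENNReal.ofReal_mul (by norm_num), ENNReal.ofReal_ofNat]
        _ = _ := by
            have : (4 : ℝ≥0∞) = 2 * 2 := by norm_num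
            rw [div_eq_mul_inv, this]
            calc _ = rearr μ f (δ * 2 ^ (n + 1)) * G (δ * 2 ^ (n + 1)) *
                  (2 * ENNReal.ofReal (δ * 2 ^ n)) * (2 * 2⁻¹) := by
                  rw [ENNReal.mul_inv_cancel (by norm_num) (by norm_num), mul_one]
              _ = _ := by ring
  have hunion : Ioi (0 : ℝ) = ⋃ m : ℕ, Ico ((2 ^ m)⁻¹) (2 ^ m) := by
    ext t
    simp only [mem_Ioi, mem_iUnion, mem_Ico]
    constructor
    · intro ht
      obtain ⟨m, hm⟩ := pow_unbounded_of_one_lt (max t t⁻¹) (by norm_num : (1 : ℝ) < 2)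
      exact ⟨m, (inv_lt_of_inv_lt₀ ht ((le_max_right _ _).trans_lt hm)).le,
        (le_max_left _ _).trans_lt hm⟩
    · rintro ⟨m, hm, -⟩
      exact lt_of_lt_of_le (by positivity) hm
  have hdir : Monotone fun m : ℕ => Ico ((2 ^ m : ℝ)⁻¹) (2 ^ m) := by
    intro a b hab
    have : (2 : ℝ) ^ a ≤ 2 ^ b := pow_le_pow_right₀ (by norm_num) hab
    exact Ico_subset_Ico (inv_anti₀ (by positivity) this) this
  rw [hunion, setLIntegral_iUnion_of_directed _ hdir.directed_le]
  refine iSup_le fun m => ?_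
  have hδ : (0 : ℝ) < (2 ^ m)⁻¹ / 2 := by positivity
  have h := (hint _ hδ (2 * m)).trans (mul_le_mul' le_rfl (hlim _ hδ (2 * m)))
  convert h using 4
  · ring
  · rw [pow_succ, two_mul, pow_add]
    field_simp

end Realization

section Associate

variable {X : Type*} [MeasurableSpace X] {μ : Measure X}

/-- Tonelli's theorem on the triangle `{0 < s < t}`. -/
theorem lintegral_lintegral_Ioo_mul (lam : Measure ℝ) [SFinite lam] {F k : ℝ → ℝ≥0∞}
    (hF : Measurable F) (hk : Measurable k) :
    ∫⁻ t, (∫⁻ s in Ioo 0 t, F s) * k t ∂lam =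
      ∫⁻ s in Ioi (0 : ℝ), F s * ∫⁻ t in Ioi s, k t ∂lam := by
  have hT : MeasurableSet {x : ℝ × ℝ | x.2 < x.1} := measurableSet_lt measurable_snd measurable_fst
  have hm : Measurable (Function.uncurry fun t s =>
      {x : ℝ × ℝ | x.2 < x.1}.indicator (fun x => F x.2 * k x.1) (t, s)) :=
    ((hF.comp measurable_snd).mul (hk.comp measurable_fst)).indicator hT
  calc ∫⁻ t, (∫⁻ s in Ioo 0 t, F s) * k t ∂lam
      = ∫⁻ t, (∫⁻ s in Ioi (0 : ℝ),
          {x : ℝ × ℝ | x.2 < x.1}.indicator (fun x => F x.2 * k x.1) (t, s)) ∂lam := by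
        refine lintegral_congr fun t => ?_
        rw [← lintegral_mul_const _ hF]
        have : Ioo 0 t = Iio t ∩ Ioi 0 := by rw [inter_comm, Ioi_inter_Iio]
        rw [this, ← Measure.restrict_restrict measurableSet_Iio,
          ← lintegral_indicator measurableSet_Iio]
        rfl
    _ = ∫⁻ s in Ioi (0 : ℝ), ∫⁻ t,
          {x : ℝ × ℝ | x.2 < x.1}.indicator (fun x => F x.2 * k x.1) (t, s) ∂lam :=
        lintegral_lintegral_swap hm.aemeasurable
    _ = _ := by
        refine lintegral_congr fun s => ?_
        rw [← lintegral_const_mul _ hk, ← lintegral_indicator measurableSet_Ioi]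
        rfl

/-- The weighted `L^{Q'}` norm of `f**` is dominated by the associate functional of the weighted
`L^Q` norm of `f*`, provided the weight satisfies Muckenhoupt's condition. -/
theorem IsNonatomic.exists_lintegral_maxf_le (hna : IsNonatomic μ) {Q Q' : ℝ}
    (hQ : Q.HolderConjugate Q') {w : ℝ → ℝ} (hwm : Measurable w) (hw : ∀ t > 0, 0 < w t)
    {B : ℝ≥0∞} (hBt : B ≠ ∞)
    (hB : ∀ t > 0, (∫⁻ s in Ioo 0 t, ENNReal.ofReal (w s ^ Q)) ^ (1 / Q) *
      (∫⁻ s in Ioi t, ENNReal.ofReal ((s * w s) ^ (-Q'))) ^ (1 / Q') ≤ B) :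
    ∃ A : ℝ≥0∞, A ≠ 0 ∧ A ≠ ∞ ∧ ∀ f : X → ℝ, Measurable f →
      (∫⁻ t in Ioi (0 : ℝ), (ENNReal.ofReal (w t)⁻¹ * maxf μ f t) ^ Q') ^ (1 / Q') ≤
        4 * A * assocNorm μ
          (fun g => (∫⁻ t in Ioi (0 : ℝ), (ENNReal.ofReal (w t) * rearr μ g t) ^ Q) ^ (1 / Q)) f := by
  have hQ0 := hQ.pos
  have hQ'0 := hQ.symm.pos
  set u : ℝ → ℝ≥0∞ := fun t => ENNReal.ofReal (w t ^ Q) with hu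
  set v : ℝ → ℝ≥0∞ := fun t => ENNReal.ofReal ((t * w t) ^ (-Q')) with hv
  have hum : Measurable u := (hwm.pow_const Q).ennreal_ofReal
  have hvm : Measurable v := ((measurable_id.mul hwm).pow_const (-Q')).ennreal_ofReal
  have hu0 : ∀ t > 0, u t ≠ 0 := fun t ht => by
    simpa [hu] using Real.rpow_pos_of_pos (hw t ht) Q
  have hv0 : ∀ t > 0, v t ≠ 0 := fun t ht => by
    simpa [hv] using Real.rpow_pos_of_pos (mul_pos ht (hw t ht)) (-Q')
  set ν : Measure ℝ := (volume.restrict (Ioi 0)).withDensity u with hνdef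
  set lam : Measure ℝ := (volume.restrict (Ioi 0)).withDensity v with hlamdef
  have : SigmaFinite ν := SigmaFinite.withDensity_ofReal _
  have : SigmaFinite lam := SigmaFinite.withDensity_ofReal _
  have hνapp : ∀ t, ν (Iio t) = ∫⁻ s in Ioo 0 t, u s := fun t => by
    rw [hνdef, withDensity_apply _ measurableSet_Iio, Measure.restrict_restrict measurableSet_Iio,
      inter_comm, Ioi_inter_Iio]
  have hlamapp : ∀ t > 0, lam (Ioi t) = ∫⁻ s in Ioi t, v s := fun t ht => by
    rw [hlamdef, withDensity_apply _ measurableSet_Ioi, Measure.restrict_restrict measurableSet_Ioi,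
      Ioi_inter_Ioi, sup_eq_left.2 (le_of_lt ht)]
  have hν : ν (Iic 0) = 0 := by
    rw [hνdef, withDensity_apply _ measurableSet_Iic, Measure.restrict_restrict measurableSet_Iic,
      inter_comm, Ioi_inter_Iic, Ioc_self]
    simp
  have hlam : lam (Iic 0) = 0 := by
    rw [hlamdef, withDensity_apply _ measurableSet_Iic, Measure.restrict_restrict measurableSet_Iic,
      inter_comm, Ioi_inter_Iic, Ioc_self]
    simp
  have hν0 : ∀ t > 0, ν (Iio t) ≠ 0 := fun t ht => by
    rw [hνapp, ← pos_iff_ne_zero, setLIntegral_pos_iff hum]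
    refine lt_of_lt_of_le ?_ (measure_mono (s := Ioo 0 t)
      fun s hs => ⟨hu0 s hs.1, hs⟩)
    simpa using ht
  have hlam0 : ∀ t > 0, lam (Ioi t) ≠ 0 := fun t ht => by
    rw [hlamapp t ht, ← pos_iff_ne_zero, setLIntegral_pos_iff hvm]
    refine lt_of_lt_of_le ?_ (measure_mono (s := Ioi t)
      fun s hs => ⟨hv0 s (ht.lt.trans hs), hs⟩)
    simp
  have hB' : ∀ t > 0, ν (Iio t) ^ (1 / Q) * lam (Ioi t) ^ (1 / Q') ≤ B := fun t ht => by
    rw [hνapp, hlamapp t ht]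
    exact hB t ht
  have hνt : ∀ t > 0, ν (Iio t) ≠ ∞ := fun t ht h => by
    refine hBt (top_le_iff.1 (le_trans ?_ (hB' t ht)))
    rw [h, ENNReal.top_rpow_of_pos (by positivity), ENNReal.top_mul]
    simp [hlam0 t ht, hQ'0.le]
  have hlamt : ∀ t > 0, lam (Ioi t) ≠ ∞ := fun t ht h => by
    refine hBt (top_le_iff.1 (le_trans ?_ (hB' t ht)))
    rw [h, ENNReal.top_rpow_of_pos (by positivity), ENNReal.mul_top]
    simp [hν0 t ht, hQ0.le]
  have hhardy := fun k (hk : Measurable k) =>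
    lintegral_hardy_rpow_le ν lam hQ hν hlam hν0 hνt hlam0 hlamt hB' (k := k) hk
  set C := (ENNReal.ofReal Q' * B) ^ (Q / Q') * (ENNReal.ofReal Q * B) with hC
  have hCt : C ≠ ∞ := ENNReal.mul_ne_top
    (ENNReal.rpow_ne_top_of_nonneg (by positivity) (ENNReal.mul_ne_top ENNReal.ofReal_ne_top hBt))
    (ENNReal.mul_ne_top ENNReal.ofReal_ne_top hBt)
  set A := C ^ (1 / Q) + 1 with hA
  have hA0 : A ≠ 0 := by simp [hA]
  have hAt : A ≠ ∞ := by
    simp only [hA, ne_eq, ENNReal.add_eq_top, ENNReal.one_ne_top, or_false]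
    exact ENNReal.rpow_ne_top_of_nonneg (by positivity) hCt
  have hCA : C ≤ A ^ Q := by
    calc C = (C ^ (1 / Q)) ^ Q := by
          rw [← ENNReal.rpow_mul, one_div, inv_mul_cancel₀ hQ0.ne', ENNReal.rpow_one]
      _ ≤ A ^ Q := ENNReal.rpow_le_rpow le_self_add hQ0.le
  refine ⟨A, hA0, hAt, fun f hf => ?_⟩
  set S := assocNorm μ
    (fun g => (∫⁻ t in Ioi (0 : ℝ), (ENNReal.ofReal (w t) * rearr μ g t) ^ Q) ^ (1 / Q)) f with hS
  have hdual := lintegral_rpow_le_of_forall_lintegral_mul_le lam hQ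
    (F := fun t => ∫⁻ s in Ioo 0 t, rearr μ f s) (K := 4 * A * S) fun k hk hk1 => by
    have hG : AntitoneOn (fun t => A⁻¹ * ∫⁻ s in Ioi t, k s ∂lam) (Ioi 0) := fun s _ t _ hst =>
      mul_le_mul_right (lintegral_mono_set (Ioi_subset_Ioi hst)) _
    have hGm : Measurable fun t => ∫⁻ s in Ioi t, k s ∂lam :=
      Antitone.measurable fun s t hst => lintegral_mono_set (Ioi_subset_Ioi hst)
    have hreal := hna.lintegral_rearr_mul_le hf hG (K := S) fun g hg hgG => by
      refine le_iSup_of_le g (le_iSup_of_le hg (le_iSup_of_le ?_ le_rfl))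
      rw [← ENNReal.one_rpow (1 / Q)]
      refine ENNReal.rpow_le_rpow ?_ (by positivity)
      calc ∫⁻ t in Ioi (0 : ℝ), (ENNReal.ofReal (w t) * rearr μ g t) ^ Q
          ≤ ∫⁻ t in Ioi (0 : ℝ), u t * ((A⁻¹) ^ Q * (∫⁻ s in Ioi t, k s ∂lam) ^ Q) := by
            refine setLIntegral_mono' measurableSet_Ioi fun t ht => ?_
            rw [← ENNReal.mul_rpow_of_nonneg _ _ hQ0.le, hu]
            beta_reduce
            rw [← ENNReal.ofReal_rpow_of_pos (hw t ht), ← ENNReal.mul_rpow_of_nonneg _ _ hQ0.le]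
            exact ENNReal.rpow_le_rpow (mul_le_mul_right (hgG t ht) _) hQ0.le
        _ = (A⁻¹) ^ Q * ∫⁻ t, (∫⁻ s in Ioi t, k s ∂lam) ^ Q ∂ν := by
            rw [← lintegral_const_mul _ (hGm.pow_const Q), hνdef,
              lintegral_withDensity_eq_lintegral_mul _ hum ((hGm.pow_const Q).const_mul _)]
            rfl
        _ ≤ (A ^ Q)⁻¹ * (A ^ Q * 1) := by
            rw [ENNReal.inv_rpow]
            exact mul_le_mul_right ((hhardy k hk).trans (mul_le_mul' hCA hk1)) _
        _ = 1 := by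
            rw [mul_one]
            exact ENNReal.inv_mul_cancel (by simp [hA0, hQ0.le])
              (ENNReal.rpow_ne_top_of_nonneg hQ0.le hAt)
    rw [lintegral_lintegral_Ioo_mul lam (measurable_rearr f) hk]
    calc ∫⁻ s in Ioi (0 : ℝ), rearr μ f s * ∫⁻ t in Ioi s, k t ∂lam
        = A * ∫⁻ s in Ioi (0 : ℝ), rearr μ f s * (A⁻¹ * ∫⁻ t in Ioi s, k t ∂lam) := by
          rw [← lintegral_const_mul (f := fun s => rearr μ f s * (A⁻¹ * ∫⁻ t in Ioi s, k t ∂lam)) _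
            ((measurable_rearr f).mul (hGm.const_mul _))]
          refine lintegral_congr fun s => ?_
          calc _ = (A * A⁻¹) * (rearr μ f s * ∫⁻ t in Ioi s, k t ∂lam) := by
                rw [ENNReal.mul_inv_cancel hA0 hAt, one_mul]
            _ = _ := by ring
      _ ≤ A * (4 * S) := mul_le_mul_right hreal _
      _ = 4 * A * S := by ring
  refine le_of_eq_of_le ?_ hdual
  have hFm : Measurable fun t => ∫⁻ s in Ioo 0 t, rearr μ f s :=
    Monotone.measurable fun s t hst => lintegral_mono_set (Ioo_subset_Ioo_right hst)
  rw [hlamdef, lintegral_withDensity_eq_lintegral_mul _ hvm (hFm.pow_const _)]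
  congr 1
  refine setLIntegral_congr_fun measurableSet_Ioi fun t ht => ?_
  have ht' : 0 < t := ht
  have hwt := hw t ht
  simp only [Pi.mul_apply, hv, maxf]
  rw [Real.rpow_neg (mul_pos ht' hwt).le, ← Real.inv_rpow (mul_pos ht' hwt).le,
    ← ENNReal.ofReal_rpow_of_pos (inv_pos.2 (mul_pos ht' hwt)),
    ← ENNReal.mul_rpow_of_nonneg _ _ hQ'0.le, ← mul_assoc, ← ENNReal.ofReal_inv_of_pos ht',
    ← ENNReal.ofReal_mul (inv_pos.2 hwt).le, mul_inv, mul_comm t⁻¹]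

/-- Hölder's inequality for rearrangements. -/
theorem assocNorm_le_lintegral_maxf [SFinite μ] {Q Q' : ℝ}
    (hQ : Q.HolderConjugate Q') {w : ℝ → ℝ} (hwm : Measurable w) (hw : ∀ t > 0, 0 < w t)
    {f : X → ℝ} (hf : Measurable f) :
    assocNorm μ
        (fun g => (∫⁻ t in Ioi (0 : ℝ), (ENNReal.ofReal (w t) * rearr μ g t) ^ Q) ^ (1 / Q)) f ≤
      (∫⁻ t in Ioi (0 : ℝ), (ENNReal.ofReal (w t)⁻¹ * maxf μ f t) ^ Q') ^ (1 / Q') := by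
  refine iSup_le fun g => iSup_le fun hg => iSup_le fun hg1 => ?_
  have hmw : Measurable fun t => ENNReal.ofReal (w t) * rearr μ g t :=
    hwm.ennreal_ofReal.mul (measurable_rearr g)
  have hmw' : Measurable fun t => ENNReal.ofReal (w t)⁻¹ * rearr μ f t :=
    hwm.inv.ennreal_ofReal.mul (measurable_rearr f)
  calc ∫⁻ x, ENNReal.ofReal |f x * g x| ∂μ
      ≤ ∫⁻ t in Ioi (0 : ℝ), rearr μ f t * rearr μ g t :=
        lintegral_abs_mul_le_lintegral_rearr_mul hf hg
    _ = ∫⁻ t in Ioi (0 : ℝ), ((fun t => ENNReal.ofReal (w t) * rearr μ g t) *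
          fun t => ENNReal.ofReal (w t)⁻¹ * rearr μ f t) t := by
        refine setLIntegral_congr_fun measurableSet_Ioi fun t ht => ?_
        have hwt := hw t ht
        have h1 : ENNReal.ofReal (w t) * ENNReal.ofReal (w t)⁻¹ = 1 := by
          rw [← ENNReal.ofReal_mul hwt.le, mul_inv_cancel₀ hwt.ne', ENNReal.ofReal_one]
        calc rearr μ f t * rearr μ g t
            = ENNReal.ofReal (w t) * ENNReal.ofReal (w t)⁻¹ * (rearr μ f t * rearr μ g t) := by
              rw [h1, one_mul]
          _ = _ := by simp only [Pi.mul_apply]; ring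
    _ ≤ _ := ENNReal.lintegral_mul_le_Lp_mul_Lq _ hQ hmw.aemeasurable hmw'.aemeasurable
    _ ≤ 1 * (∫⁻ t in Ioi (0 : ℝ), (ENNReal.ofReal (w t)⁻¹ * rearr μ f t) ^ Q') ^ (1 / Q') :=
        mul_le_mul_left hg1 _
    _ ≤ _ := by
        rw [one_mul]
        have hQ'0 := hQ.symm.pos
        refine ENNReal.rpow_le_rpow (setLIntegral_mono' measurableSet_Ioi fun t ht => ?_)
          (by positivity)
        exact ENNReal.rpow_le_rpow (mul_le_mul_right (rearr_le_maxf f ht) _) hQ'0.le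

end Associate

theorem IsSlowlyVarying.exists_rpow_mul_le {b : ℝ → ℝ} (hb : IsSlowlyVarying b) {ε : ℝ}
    (hε : 0 < ε) :
    ∃ D : ℝ, 0 < D ∧ ∀ s t, 0 < s → s ≤ t → s ^ ε * b s ≤ D * (t ^ ε * b t) := by
  obtain ⟨⟨bp, hmono, c, C, hc, hC, hbp⟩, -⟩ := hb.2.2 ε hε
  refine ⟨C / c, by positivity, fun s t hs hst => ?_⟩
  have ht : 0 < t := hs.trans_le hst
  calc s ^ ε * b s ≤ C * bp s := (hbp s hs).2
    _ ≤ C * bp t := mul_le_mul_of_nonneg_left (hmono hs ht hst) hC.le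
    _ = C / c * (c * bp t) := by field_simp
    _ ≤ C / c * (t ^ ε * b t) := mul_le_mul_of_nonneg_left (hbp t ht).1 (by positivity)

/-- Muckenhoupt's condition for `t ^ (r - 1 / Q) * b t` when `r > 0`. -/
theorem IsSlowlyVarying.exists_muckenhoupt {b : ℝ → ℝ} (hb : IsSlowlyVarying b) {r Q Q' : ℝ}
    (hr : 0 < r) (hQ : Q.HolderConjugate Q') :
    ∃ B : ℝ≥0∞, B ≠ ∞ ∧ ∀ t > 0,
      (∫⁻ s in Ioo 0 t, ENNReal.ofReal ((s ^ (r - Q⁻¹) * b s) ^ Q)) ^ (1 / Q) *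
        (∫⁻ s in Ioi t, ENNReal.ofReal ((s * (s ^ (r - Q⁻¹) * b s)) ^ (-Q'))) ^ (1 / Q') ≤ B := by
  have hQ0 := hQ.pos
  have hQ'0 := hQ.symm.pos
  have hsum := hQ.inv_add_inv_eq_one
  set ε := r / 2 with hεdef
  have hε : 0 < ε := by positivity
  obtain ⟨D, hD, hmono⟩ := hb.exists_rpow_mul_le hε
  have hεQ : 0 < ε * Q := by positivity
  have hεQ' : 0 < ε * Q' := by positivity
  refine ⟨ENNReal.ofReal (D * D * ((ε * Q) ^ (-(1 / Q)) * (ε * Q') ^ (-(1 / Q')))),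
    ENNReal.ofReal_ne_top, fun t ht => ?_⟩
  have hbt : 0 < b t := hb.2.1 t ht
  set e := t ^ ε * b t with he
  have he0 : 0 < e := mul_pos (Real.rpow_pos_of_pos ht _) hbt
  have h1 : ∫⁻ s in Ioo 0 t, ENNReal.ofReal ((s ^ (r - Q⁻¹) * b s) ^ Q) ≤
      ENNReal.ofReal ((D * e) ^ Q * (t ^ (ε * Q) / (ε * Q))) := by
    rw [ENNReal.ofReal_mul (by positivity), ← lintegral_Ioo_rpow_sub_one hεQ ht,
      ← lintegral_const_mul _ (by fun_prop)]
    refine setLIntegral_mono' measurableSet_Ioo fun s hs => ?_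
    have hs0 : 0 < s := hs.1
    have hbs : 0 < b s := hb.2.1 s hs0
    rw [← ENNReal.ofReal_mul (by positivity)]
    refine ENNReal.ofReal_le_ofReal ?_
    calc (s ^ (r - Q⁻¹) * b s) ^ Q = (s ^ ε * b s * s ^ (ε - Q⁻¹)) ^ Q := by
          rw [mul_right_comm, ← Real.rpow_add hs0]
          congr 3
          rw [hεdef]; ring
      _ ≤ (D * e * s ^ (ε - Q⁻¹)) ^ Q := by
          refine Real.rpow_le_rpow (by positivity) ?_ hQ0.le
          exact mul_le_mul_of_nonneg_right (hmono s t hs0 hs.2.le) (by positivity)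
      _ = (D * e) ^ Q * s ^ (ε * Q - 1) := by
          rw [Real.mul_rpow (by positivity) (by positivity), ← Real.rpow_mul hs0.le, sub_mul,
            inv_mul_cancel₀ hQ0.ne']
  have h2 : ∫⁻ s in Ioi t, ENNReal.ofReal ((s * (s ^ (r - Q⁻¹) * b s)) ^ (-Q')) ≤
      ENNReal.ofReal ((e / D) ^ (-Q') * (t ^ (-(ε * Q')) / (ε * Q'))) := by
    rw [ENNReal.ofReal_mul (by positivity), ← lintegral_Ioi_rpow_neg_sub_one hεQ' ht,
      ← lintegral_const_mul _ (by fun_prop)]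
    refine setLIntegral_mono' measurableSet_Ioi fun s hs => ?_
    have hs0 : 0 < s := ht.trans hs
    have hbs : 0 < b s := hb.2.1 s hs0
    rw [← ENNReal.ofReal_mul (by positivity)]
    refine ENNReal.ofReal_le_ofReal ?_
    calc (s * (s ^ (r - Q⁻¹) * b s)) ^ (-Q') = (s ^ ε * b s * s ^ (ε + Q'⁻¹)) ^ (-Q') := by
          nth_rewrite 1 [← Real.rpow_one s]
          rw [← mul_assoc, ← Real.rpow_add hs0, mul_right_comm, ← Real.rpow_add hs0]
          congr 3
          rw [hεdef]; linarith
      _ ≤ (e / D * s ^ (ε + Q'⁻¹)) ^ (-Q') := by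
          refine Real.rpow_le_rpow_of_nonpos (by positivity) ?_ (by linarith)
          refine mul_le_mul_of_nonneg_right ?_ (by positivity)
          rw [div_le_iff₀' hD]
          exact hmono t s ht (le_of_lt hs)
      _ = (e / D) ^ (-Q') * s ^ (-(ε * Q') - 1) := by
          rw [Real.mul_rpow (by positivity) (by positivity), ← Real.rpow_mul hs0.le]
          congr 2
          field_simp
          ring
  refine (mul_le_mul' (ENNReal.rpow_le_rpow h1 (by positivity))
    (ENNReal.rpow_le_rpow h2 (by positivity))).trans (le_of_eq ?_)
  rw [ENNReal.ofReal_rpow_of_pos (by positivity), ENNReal.ofReal_rpow_of_pos (by positivity),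
    ← ENNReal.ofReal_mul (by positivity)]
  congr 1
  have hx : ((D * e) ^ Q * (t ^ (ε * Q) / (ε * Q))) ^ (1 / Q) =
      D * e * t ^ ε * (ε * Q) ^ (-(1 / Q)) := by
    rw [div_eq_mul_inv, Real.mul_rpow (x := (D * e) ^ Q) (by positivity) (by positivity),
      Real.mul_rpow (x := t ^ (ε * Q)) (by positivity) (by positivity),
      ← Real.rpow_mul (by positivity), ← Real.rpow_mul ht.le, mul_one_div_cancel hQ0.ne',
      Real.rpow_one, mul_assoc ε,
      mul_one_div_cancel hQ0.ne', mul_one, Real.inv_rpow (by positivity),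
      Real.rpow_neg (by positivity)]
    ring
  have hy : ((e / D) ^ (-Q') * (t ^ (-(ε * Q')) / (ε * Q'))) ^ (1 / Q') =
      D / e * (t ^ ε)⁻¹ * (ε * Q') ^ (-(1 / Q')) := by
    have h3 : -Q' * (1 / Q') = -1 := by field_simp
    have h4 : -(ε * Q') * (1 / Q') = -ε := by field_simp
    rw [div_eq_mul_inv (t ^ _), Real.mul_rpow (by positivity) (by positivity),
      Real.mul_rpow (by positivity) (by positivity), ← Real.rpow_mul (by positivity),
      ← Real.rpow_mul ht.le, h3, h4, Real.rpow_neg_one, inv_div, Real.rpow_neg ht.le,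
      Real.inv_rpow (by positivity), Real.rpow_neg (by positivity) (1 / Q'), mul_assoc]
  have hte : 0 < t ^ ε := Real.rpow_pos_of_pos ht _
  rw [hx, hy]
  clear_value e
  field_simp

/-- Theorem TAS: for `q ∈ (1,∞)`, under condition (1) or (2),
`(L^{p,q,b})' = L^{(p',q',b⁻¹)}` up to equivalence of the defining functionals. -/
theorem lk_assoc_eq_max {X : Type*} [MeasurableSpace X] (μ : Measure X)
    [SigmaFinite μ] (hna : IsNonatomic μ) (hμ : μ Set.univ = ∞)
    (p q : ℝ≥0∞) (hq1 : 1 < q) (hq2 : q < ∞) (b : ℝ → ℝ) (hb : IsSlowlyVarying b)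
    (hcase : (1 ≤ p ∧ p < ∞) ∨
      (p = ∞ ∧ (∫⁻ t in Set.Ioi (1:ℝ), ENNReal.ofReal (t⁻¹ * b t ^ q.toReal)) = ∞ ∧
        ∃ C : ℝ≥0∞, C < ∞ ∧ ∀ t ∈ Set.Ioi (0:ℝ),
          (∫⁻ s in Set.Ioo (0:ℝ) t, ENNReal.ofReal (s⁻¹ * b s ^ q.toReal)) ^ (1 / q.toReal) *
            (∫⁻ s in Set.Ioi t, ENNReal.ofReal (s⁻¹ * b s ^ (-(conjE q).toReal))) ^
              (1 / (conjE q).toReal) ≤ C)) :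
    ∃ c C : ℝ≥0∞, 0 < c ∧ C < ∞ ∧ ∀ f : X → ℝ, Measurable f →
      c * lkMaxNorm μ (conjE p) (conjE q) (fun t => (b t)⁻¹) f ≤
        assocNorm μ (lkNorm μ p q b) f ∧
      assocNorm μ (lkNorm μ p q b) f ≤
        C * lkMaxNorm μ (conjE p) (conjE q) (fun t => (b t)⁻¹) f := by
  have hq0 : q ≠ 0 := (zero_lt_one.trans hq1).ne'
  have hqinv : q⁻¹ < 1 := ENNReal.inv_lt_one.2 hq1
  have hcq : (conjE q)⁻¹ = 1 - q⁻¹ := inv_inv _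
  have hcqt : conjE q ≠ ∞ := by
    rw [conjE, ne_eq, ENNReal.inv_eq_top, tsub_eq_zero_iff_le, not_le]
    exact hqinv
  have hp1 : 1 ≤ p := by
    rcases hcase with h | h
    · exact h.1
    · simp [h.1]
  have hcqr : (conjE q)⁻¹.toReal = 1 - q⁻¹.toReal := by
    rw [hcq, ENNReal.toReal_sub_of_le hqinv.le ENNReal.one_ne_top, ENNReal.toReal_one]
  have hcpr : (conjE p)⁻¹.toReal = 1 - p⁻¹.toReal := by
    rw [conjE, inv_inv, ENNReal.toReal_sub_of_le (ENNReal.inv_le_one.2 hp1) ENNReal.one_ne_top,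
      ENNReal.toReal_one]
  have hQ : q.toReal.HolderConjugate (conjE q).toReal := by
    rw [Real.holderConjugate_iff]
    refine ⟨by simpa using (ENNReal.toReal_lt_toReal ENNReal.one_ne_top hq2.ne).2 hq1, ?_⟩
    rw [← ENNReal.toReal_inv, ← ENNReal.toReal_inv, hcqr]
    ring
  have hQ0 := hQ.pos
  have hQ'0 := hQ.symm.pos
  set w : ℝ → ℝ := fun t => t ^ (p⁻¹.toReal - q⁻¹.toReal) * b t with hw_def
  have hwm : Measurable w := (measurable_id.pow_const _).mul hb.1
  have hw : ∀ t > 0, 0 < w t := fun t ht => mul_pos (Real.rpow_pos_of_pos ht _) (hb.2.1 t ht)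
  have hlk : lkNorm μ p q b = fun g : X → ℝ =>
      (∫⁻ t in Ioi (0 : ℝ), (ENNReal.ofReal (w t) * rearr μ g t) ^ q.toReal) ^ (1 / q.toReal) := by
    funext g
    rw [lkNorm, lqNorm, if_neg hq2.ne]
  have hmax : ∀ f : X → ℝ, lkMaxNorm μ (conjE p) (conjE q) (fun t => (b t)⁻¹) f =
      (∫⁻ t in Ioi (0 : ℝ), (ENNReal.ofReal (w t)⁻¹ * maxf μ f t) ^ (conjE q).toReal) ^
        (1 / (conjE q).toReal) := by
    intro f
    rw [lkMaxNorm, lqNorm, if_neg hcqt, hcqr, hcpr]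
    congr 1
    refine setLIntegral_congr_fun measurableSet_Ioi fun t ht => ?_
    rw [hw_def, mul_inv, ← Real.rpow_neg (le_of_lt ht)]
    congr 5
    ring
  have hmuck : ∃ B : ℝ≥0∞, B ≠ ∞ ∧ ∀ t > 0,
      (∫⁻ s in Ioo 0 t, ENNReal.ofReal (w s ^ q.toReal)) ^ (1 / q.toReal) *
        (∫⁻ s in Ioi t, ENNReal.ofReal ((s * w s) ^ (-(conjE q).toReal))) ^
          (1 / (conjE q).toReal) ≤ B := by
    rcases hcase with ⟨-, hpt⟩ | ⟨rfl, -, C, hC, hle⟩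
    · have hr : 0 < p⁻¹.toReal :=
        ENNReal.toReal_pos (ENNReal.inv_ne_zero.2 hpt.ne)
          (ENNReal.inv_ne_top.2 (zero_lt_one.trans_le hp1).ne')
      simpa only [hw_def, ENNReal.toReal_inv q] using hb.exists_muckenhoupt hr hQ
    · refine ⟨C, hC.ne, fun t ht => le_of_eq_of_le ?_ (hle t ht)⟩
      congr 2
      · refine setLIntegral_congr_fun measurableSet_Ioo fun s hs => ?_
        have hs0 : 0 < s := hs.1
        have hbs := hb.2.1 s hs0
        simp only [hw_def, ENNReal.inv_top, ENNReal.toReal_zero, zero_sub]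
        rw [Real.mul_rpow (by positivity) hbs.le, ← Real.rpow_mul hs0.le, ENNReal.toReal_inv,
          neg_mul, inv_mul_cancel₀ hQ0.ne', Real.rpow_neg_one]
      · refine setLIntegral_congr_fun measurableSet_Ioi fun s hs => ?_
        have hs0 : 0 < s := ht.lt.trans hs
        have hbs := hb.2.1 s hs0
        simp only [hw_def, ENNReal.inv_top, ENNReal.toReal_zero, zero_sub]
        have hexp : s * (s ^ (-q⁻¹.toReal) * b s) = s ^ (conjE q).toReal⁻¹ * b s := by
          nth_rewrite 1 [← Real.rpow_one s]
          rw [← mul_assoc, ← Real.rpow_add hs0, ← ENNReal.toReal_inv, hcqr, sub_eq_add_neg]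
        rw [hexp, Real.mul_rpow (by positivity) hbs.le, ← Real.rpow_mul hs0.le, mul_neg,
          inv_mul_cancel₀ hQ'0.ne', Real.rpow_neg_one]
  obtain ⟨B, hBt, hB⟩ := hmuck
  obtain ⟨A, hA0, hAt, hA⟩ := hna.exists_lintegral_maxf_le (μ := μ) hQ hwm hw hBt hB
  have h4A0 : 4 * A ≠ 0 := mul_ne_zero (by norm_num) hA0
  have h4At : 4 * A ≠ ∞ := ENNReal.mul_ne_top (by norm_num) hAt
  refine ⟨(4 * A)⁻¹, 1, ENNReal.inv_pos.2 h4At, ENNReal.one_lt_top, fun f hf => ?_⟩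
  rw [hlk, hmax, one_mul]
  refine ⟨?_, assocNorm_le_lintegral_maxf hQ hwm hw hf⟩
  rw [mul_comm, ← div_eq_mul_inv]
  exact ENNReal.div_le_of_le_mul' (hA f hf)
end

section
/- Let b be a slowly varying function, q = ∞, and p ∈ [1,∞]; if p = ∞, assume additionally that b is non-decreasing. Then (L^{p,∞,b})' = L^{p',1,b^{−1}} up to equivalence of the defining functionals, where p' = p/(p−1) for p ∈ (1,∞), p' = ∞ for p = 1, and p' = 1 for p = ∞. -/
open MeasureTheory Set Filter ENNReal Topology

namespace LorentzKaramata

variable {X : Type*} [MeasurableSpace X] {μ : Measure X}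

/-- In a non-atomic measure, every set of positive measure has a measurable subset of positive
measure which is as small as desired. -/
lemma exists_small_subset (hna : IsNonatomic μ) {s : Set X} (hs : MeasurableSet s)
    (h0 : 0 < μ s) {ε : ℝ≥0∞} (hε : 0 < ε) :
    ∃ t, t ⊆ s ∧ MeasurableSet t ∧ 0 < μ t ∧ μ t ≤ ε := by
  obtain ⟨r, hrs, hr, hr0, hrlt⟩ := hna s hs h0
  have hrfin : μ r ≠ ∞ := hrlt.ne_top
  have halve : ∀ n : ℕ, ∃ t, t ⊆ r ∧ MeasurableSet t ∧ 0 < μ t ∧ μ t ≤ μ r * (2⁻¹) ^ n := by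
    intro n
    induction n with
    | zero => exact ⟨r, Subset.rfl, hr, hr0, by simp⟩
    | succ n ih =>
      obtain ⟨t, htr, ht, ht0, htle⟩ := ih
      obtain ⟨u, hut, hu, hu0, hult⟩ := hna t ht ht0
      have hufin : μ u ≠ ∞ := hult.ne_top
      have hadd : μ (t \ u) + μ u = μ t := by
        have := measure_sdiff_add_inter t hu (μ := μ)
        rwa [inter_eq_self_of_subset_right hut] at this
      have hd0 : 0 < μ (t \ u) := by
        rw [pos_iff_ne_zero]
        intro h
        rw [h, zero_add] at hadd
        exact hult.ne hadd
      have key : ∀ a b : ℝ≥0∞, a + b = μ t → a ≤ b → a ≤ μ r * (2⁻¹) ^ (n + 1) := by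
        intro a b hab hle
        have h2 : 2 * a ≤ μ t := by rw [two_mul, ← hab]; gcongr
        calc a = 2⁻¹ * (2 * a) := by
              rw [← mul_assoc, ENNReal.inv_mul_cancel (by simp) (by simp), one_mul]
          _ ≤ 2⁻¹ * (μ r * (2⁻¹) ^ n) := by exact mul_le_mul_right (h2.trans htle) _
          _ = μ r * (2⁻¹) ^ (n + 1) := by ring
      rcases le_total (μ (t \ u)) (μ u) with h | h
      · exact ⟨t \ u, sdiff_subset.trans htr, ht.diff hu, hd0, key _ _ hadd h⟩
      · exact ⟨u, hut.trans htr, hu, hu0, key _ _ (by rw [add_comm]; exact hadd) h⟩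
  have hlim : Tendsto (fun n : ℕ => μ r * (2⁻¹ : ℝ≥0∞) ^ n) atTop (𝓝 (μ r * 0)) := by
    refine ENNReal.Tendsto.const_mul ?_ (Or.inr hrfin)
    exact ENNReal.tendsto_pow_atTop_nhds_zero_of_lt_one (by simp)
  rw [mul_zero] at hlim
  obtain ⟨n, hn⟩ := (hlim.eventually (gt_mem_nhds hε)).exists
  obtain ⟨t, htr, ht, ht0, htle⟩ := halve n
  exact ⟨t, htr.trans hrs, ht, ht0, htle.trans hn.le⟩

/-- Sierpiński's theorem: a non-atomic measure attains all intermediate values. -/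
lemma exists_subset_measure_eq (hna : IsNonatomic μ) {s : Set X} (hs : MeasurableSet s)
    {a : ℝ≥0∞} (ha : a ≠ ∞) (has : a ≤ μ s) :
    ∃ t, t ⊆ s ∧ MeasurableSet t ∧ μ t = a := by
  set adm : Set X → Set X → Prop := fun E D =>
    D ⊆ s \ E ∧ MeasurableSet D ∧ μ E + μ D ≤ a with hadm
  set best : Set X → ℝ≥0∞ := fun E => ⨆ (D : Set X) (_ : adm E D), μ D with hbest
  have hstep : ∀ E : Set X, μ E ≤ a → ∃ D, adm E D ∧ best E / 2 ≤ μ D := by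
    intro E hE
    by_cases h0 : best E = 0
    · exact ⟨∅, ⟨empty_subset _, MeasurableSet.empty, by simpa using hE⟩, by simp [h0]⟩
    · have hfin : best E ≠ ∞ := by
        refine ne_top_of_le_ne_top ha ?_
        exact iSup₂_le fun D hD => le_trans le_add_self hD.2.2
      have hlt : best E / 2 < best E := ENNReal.half_lt_self h0 hfin
      obtain ⟨D, hD⟩ := lt_iSup_iff.1 hlt
      obtain ⟨hD', hlt'⟩ := lt_iSup_iff.1 hD
      exact ⟨D, hD', hlt'.le⟩
  choose! next hnext using hstep
  let E : ℕ → Set X := fun n => Nat.rec ∅ (fun _ A => A ∪ next A) n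
  have hE0 : E 0 = ∅ := rfl
  have hEs : ∀ n, E (n + 1) = E n ∪ next (E n) := fun n => rfl
  have hinv : ∀ n, E n ⊆ s ∧ MeasurableSet (E n) ∧ μ (E n) ≤ a := by
    intro n
    induction n with
    | zero => simp [hE0]
    | succ n ih =>
      obtain ⟨h1, h2, h3⟩ := ih
      obtain ⟨⟨k1, k2, k3⟩, -⟩ := hnext _ h3
      rw [hEs]
      exact ⟨union_subset h1 (k1.trans sdiff_subset), h2.union k2, (measure_union_le _ _).trans k3⟩
  have hmono : Monotone E := monotone_nat_of_le_succ fun n => by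
    rw [hEs]; exact subset_union_left
  have hU : μ (⋃ n, E n) = ⨆ n, μ (E n) := hmono.measure_iUnion
  have hUle : μ (⋃ n, E n) ≤ a := by rw [hU]; exact iSup_le fun n => (hinv n).2.2
  have hUm : MeasurableSet (⋃ n, E n) := MeasurableSet.iUnion fun n => (hinv n).2.1
  refine ⟨⋃ n, E n, iUnion_subset fun n => (hinv n).1, hUm, ?_⟩
  by_contra hne
  have hlt : μ (⋃ n, E n) < a := lt_of_le_of_ne hUle hne
  have hrest : 0 < μ (s \ ⋃ n, E n) :=
    (tsub_pos_of_lt (hlt.trans_le has)).trans_le le_measure_sdiff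
  obtain ⟨D, hDs, hDm, hD0, hDle⟩ := exists_small_subset hna (hs.diff hUm) hrest
    (tsub_pos_of_lt hlt)
  have hDbest : ∀ n, μ D ≤ best (E n) := by
    intro n
    refine le_iSup₂_of_le D ⟨?_, hDm, ?_⟩ le_rfl
    · exact hDs.trans (sdiff_subset_sdiff_right (subset_iUnion E n))
    · calc μ (E n) + μ D ≤ μ (⋃ n, E n) + (a - μ (⋃ n, E n)) :=
            add_le_add (measure_mono (subset_iUnion E n)) hDle
        _ = a := add_tsub_cancel_of_le hUle
  have hgrow : ∀ n : ℕ, (n : ℝ≥0∞) * (μ D / 2) ≤ μ (E n) := by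
    intro n
    induction n with
    | zero => simp
    | succ n ih =>
      obtain ⟨⟨k1, k2, k3⟩, k4⟩ := hnext _ (hinv n).2.2
      rw [hEs, measure_union (disjoint_sdiff_right.mono_right k1) k2]
      push_cast
      rw [add_mul, one_mul]
      exact add_le_add ih ((ENNReal.div_le_div_right (hDbest n) 2).trans k4)
  have hD2 : μ D / 2 ≠ 0 := (ENNReal.half_pos hD0.ne').ne'
  obtain ⟨n, hn⟩ := ENNReal.exists_nat_mul_gt hD2 ha
  exact absurd ((hgrow n).trans (hinv n).2.2) (not_le.2 hn)

/-- Interpolation form of Sierpiński's theorem: a measurable set of prescribed measure between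
two nested sets. -/
lemma exists_between_measure_eq (hna : IsNonatomic μ) {r s : Set X} (hr : MeasurableSet r)
    (hs : MeasurableSet s) (hrs : r ⊆ s) {a : ℝ≥0∞} (ha : a ≠ ∞) (hra : μ r ≤ a)
    (has : a ≤ μ s) : ∃ t, r ⊆ t ∧ t ⊆ s ∧ MeasurableSet t ∧ μ t = a := by
  obtain ⟨u, hu, hum, hua⟩ := exists_subset_measure_eq hna (hs.diff hr) (a := a - μ r)
    (ne_top_of_le_ne_top ha tsub_le_self) ((tsub_le_tsub_right has _).trans le_measure_sdiff)
  refine ⟨r ∪ u, subset_union_left, union_subset hrs (hu.trans sdiff_subset), hr.union hum, ?_⟩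
  rw [measure_union (disjoint_sdiff_right.mono_right hu) hum, hua, add_tsub_cancel_of_le hra]

/-- An increasing sequence of sets carries an increasing sequence of subsets of prescribed
measures. -/
lemma exists_monotone_measure_eq (hna : IsNonatomic μ) {F : ℕ → Set X}
    (hF : ∀ j, MeasurableSet (F j)) (hFm : Monotone F) {a : ℕ → ℝ≥0∞} (ham : Monotone a)
    (ha : ∀ j, a j ≠ ∞) (haF : ∀ j, a j ≤ μ (F j)) :
    ∃ E : ℕ → Set X, Monotone E ∧ (∀ j, E j ⊆ F j) ∧ (∀ j, MeasurableSet (E j)) ∧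
      ∀ j, μ (E j) = a j := by
  have hstep : ∀ (j : ℕ) (A : Set X), (A ⊆ F j ∧ MeasurableSet A ∧ μ A = a j) →
      ∃ B, A ⊆ B ∧ B ⊆ F (j + 1) ∧ MeasurableSet B ∧ μ B = a (j + 1) := by
    rintro j A ⟨h1, h2, h3⟩
    exact exists_between_measure_eq hna h2 (hF _) (h1.trans (hFm j.le_succ)) (ha _)
      (h3.le.trans (ham j.le_succ)) (haF _)
  choose! next hnext using hstep
  obtain ⟨E₀, hE₀⟩ := exists_subset_measure_eq hna (hF 0) (ha 0) (haF 0)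
  let E : ℕ → Set X := fun n => Nat.rec E₀ (fun j A => next j A) n
  have hinv : ∀ j, E j ⊆ F j ∧ MeasurableSet (E j) ∧ μ (E j) = a j := by
    intro j
    induction j with
    | zero => exact hE₀
    | succ j ih => exact (hnext j (E j) ih).2
  exact ⟨E, monotone_nat_of_le_succ fun j => (hnext j (E j) (hinv j)).1,
    fun j => (hinv j).1, fun j => (hinv j).2.1, fun j => (hinv j).2.2⟩

lemma rearr_antitone (f : X → ℝ) : Antitone (rearr μ f) := fun _ _ h =>
  sInf_le_sInf fun _ hs => le_trans hs (ENNReal.ofReal_le_ofReal h)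

lemma lt_measure_of_lt_rearr {f : X → ℝ} {t : ℝ} {s : ℝ≥0∞} (h : s < rearr μ f t) :
    ENNReal.ofReal t < μ {x | s < ENNReal.ofReal |f x|} := by
  by_contra hc
  have : rearr μ f t ≤ s := sInf_le (mem_ofPred.2 (not_lt.1 hc))
  exact absurd this (not_le.2 h)

lemma le_rearr_of_lt_measure {f : X → ℝ} {t : ℝ} {s : ℝ≥0∞}
    (h : ENNReal.ofReal t < μ {x | s < ENNReal.ofReal |f x|}) : s ≤ rearr μ f t := by
  refine le_sInf fun r hr => ?_
  by_contra hc
  have : μ {x | s < ENNReal.ofReal |f x|} ≤ μ {x | r < ENNReal.ofReal |f x|} :=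
    measure_mono fun x hx => (not_le.1 hc).trans hx
  exact absurd (this.trans hr) (not_le.2 h)

lemma volume_Ioi_inter_le (c : ℝ≥0∞) :
    volume (Ioi (0 : ℝ) ∩ {r | ENNReal.ofReal r ≤ c}) ≤ c := by
  by_cases hc : c = ∞
  · simp [hc]
  · calc volume (Ioi (0 : ℝ) ∩ {r | ENNReal.ofReal r ≤ c})
        ≤ volume (Ioc (0 : ℝ) c.toReal) := by
          refine measure_mono fun r hr => ⟨hr.1, ?_⟩
          exact (ENNReal.ofReal_le_iff_le_toReal hc).1 hr.2
      _ = c := by simp [hc]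

lemma volume_Ioi_inter_lt (c : ℝ≥0∞) :
    volume (Ioi (0 : ℝ) ∩ {r | ENNReal.ofReal r < c}) = c := by
  by_cases hc : c = ∞
  · simp [hc]
  · have : Ioi (0 : ℝ) ∩ {r | ENNReal.ofReal r < c} = Ioo 0 c.toReal := by
      ext r
      simp only [mem_inter_iff, mem_Ioi, mem_ofPred_eq, mem_Ioo]
      exact and_congr_right fun h => ENNReal.ofReal_lt_iff_lt_toReal h.le hc
    rw [this]
    simp [hc]

/-- The distribution function of `f` at `s`. -/
def distr (μ : Measure X) (f : X → ℝ) (s : ℝ) : ℝ≥0∞ :=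
  μ {x | ENNReal.ofReal s < ENNReal.ofReal |f x|}

lemma distr_antitone (f : X → ℝ) : Antitone (distr μ f) := fun _ _ h =>
  measure_mono fun _ hx => lt_of_le_of_lt (ENNReal.ofReal_le_ofReal h) hx

lemma measurableSet_lt_distr (f : X → ℝ) :
    MeasurableSet {z : ℝ × ℝ | ENNReal.ofReal z.2 < distr μ f z.1} :=
  measurableSet_lt (ENNReal.measurable_ofReal.comp measurable_snd)
    ((distr_antitone f).measurable.comp measurable_fst)

lemma lintegral_indicator_lt_distr_le (f : X → ℝ) (t : ℝ) :
    ∫⁻ s in Ioi (0 : ℝ), {s | ENNReal.ofReal t < distr μ f s}.indicator (fun _ => 1) s ≤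
      rearr μ f t := by
  have hm : MeasurableSet {s | ENNReal.ofReal t < distr μ f s} :=
    measurableSet_lt measurable_const (distr_antitone f).measurable
  rw [lintegral_indicator hm, setLIntegral_one, Measure.restrict_apply hm, inter_comm]
  refine le_trans (measure_mono (inter_subset_inter_right _ ?_)) (volume_Ioi_inter_le _)
  exact fun s hs => le_rearr_of_lt_measure hs

lemma lintegral_abs_eq (f : X → ℝ) (hf : Measurable f) (ν : Measure X) :
    ∫⁻ x, ENNReal.ofReal |f x| ∂ν = ∫⁻ s in Ioi (0 : ℝ), distr ν f s := by
  rw [lintegral_eq_lintegral_meas_lt ν (Eventually.of_forall fun x => abs_nonneg (f x))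
    hf.abs.aemeasurable]
  refine setLIntegral_congr_fun measurableSet_Ioi fun s hs => ?_
  unfold distr
  congr 1
  ext x
  simp only [mem_ofPred_eq]
  exact (ENNReal.ofReal_lt_ofReal_iff_of_nonneg (le_of_lt hs)).symm

/-- The integral of `|g|` over a set is controlled by the integral of the rearrangement. -/
lemma setLIntegral_abs_le (g : X → ℝ) (hg : Measurable g) (A : Set X) :
    ∫⁻ x in A, ENNReal.ofReal |g x| ∂μ ≤
      ∫⁻ t in Ioi (0 : ℝ), {t | ENNReal.ofReal t < μ A}.indicator (rearr μ g) t := by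
  rw [lintegral_abs_eq g hg]
  have hA : MeasurableSet {t | ENNReal.ofReal t < μ A} :=
    measurableSet_lt ENNReal.measurable_ofReal measurable_const
  have hpt : ∀ r, distr (μ.restrict A) g r ≤ ∫⁻ t in Ioi (0 : ℝ),
      {t | ENNReal.ofReal t < μ A}.indicator
        (fun t => {r | ENNReal.ofReal t < distr μ g r}.indicator (fun _ => 1) r) t := by
    intro r
    have h1 : distr (μ.restrict A) g r ≤ min (μ A) (distr μ g r) := by
      refine le_min ?_ (Measure.restrict_apply_le _ _)
      exact (measure_mono (subset_univ _)).trans (by simp)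
    refine h1.trans ?_
    rw [lintegral_indicator hA]
    have h2 : (fun t => {r | ENNReal.ofReal t < distr μ g r}.indicator
        (fun _ => (1 : ℝ≥0∞)) r) =
        {t | ENNReal.ofReal t < distr μ g r}.indicator (fun _ => 1) := by
      ext t
      simp [indicator]
    have hm : MeasurableSet {t | ENNReal.ofReal t < distr μ g r} :=
      measurableSet_lt ENNReal.measurable_ofReal measurable_const
    rw [h2, lintegral_indicator hm, setLIntegral_one, Measure.restrict_apply hm,
      Measure.restrict_apply (hm.inter hA)]
    have h3 : {t | ENNReal.ofReal t < distr μ g r} ∩ {t | ENNReal.ofReal t < μ A} ∩ Ioi 0 =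
        Ioi (0 : ℝ) ∩ {t | ENNReal.ofReal t < min (μ A) (distr μ g r)} := by
      ext t
      simp only [mem_inter_iff, mem_ofPred_eq, mem_Ioi, lt_min_iff]
      tauto
    rw [h3, volume_Ioi_inter_lt]
  refine (lintegral_mono hpt).trans ?_
  rw [lintegral_lintegral_swap]
  · refine lintegral_mono fun t => ?_
    by_cases ht : ENNReal.ofReal t < μ A
    · simp only [indicator, mem_ofPred_eq, ht, if_true]
      simpa only [indicator, mem_ofPred_eq] using lintegral_indicator_lt_distr_le (μ := μ) g t
    · simp [indicator, ht]
  · refine Measurable.aemeasurable ?_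
    have : (Function.uncurry fun r t => {t | ENNReal.ofReal t < μ A}.indicator
        (fun t => {r | ENNReal.ofReal t < distr μ g r}.indicator
          (fun _ => (1 : ℝ≥0∞)) r) t) =
        (Prod.snd ⁻¹' {t | ENNReal.ofReal t < μ A} ∩
          {z : ℝ × ℝ | ENNReal.ofReal z.2 < distr μ g z.1}).indicator (fun _ => 1) := by
      ext ⟨r, t⟩
      by_cases h1 : ENNReal.ofReal t < μ A <;> simp [indicator, Function.uncurry, h1]
    rw [this]
    exact measurable_const.indicator ((measurable_snd hA).inter (measurableSet_lt_distr g))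

/-- The Hardy–Littlewood inequality. -/
lemma lintegral_mul_le_lintegral_rearr_mul (f g : X → ℝ) (hf : Measurable f)
    (hg : Measurable g) :
    ∫⁻ x, ENNReal.ofReal |f x * g x| ∂μ ≤
      ∫⁻ t in Ioi (0 : ℝ), rearr μ f t * rearr μ g t := by
  have hgm : Measurable fun x => ENNReal.ofReal |g x| := hg.abs.ennreal_ofReal
  have hstart : ∫⁻ x, ENNReal.ofReal |f x * g x| ∂μ =
      ∫⁻ x, ENNReal.ofReal |f x| ∂(μ.withDensity fun x => ENNReal.ofReal |g x|) := by
    rw [lintegral_withDensity_eq_lintegral_mul _ hgm hf.abs.ennreal_ofReal]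
    refine lintegral_congr fun x => ?_
    rw [abs_mul, ENNReal.ofReal_mul (abs_nonneg _), Pi.mul_apply, mul_comm]
  rw [hstart, lintegral_abs_eq f hf]
  have hpt : ∀ s, distr (μ.withDensity fun x => ENNReal.ofReal |g x|) f s ≤
      ∫⁻ t in Ioi (0 : ℝ),
        {s | ENNReal.ofReal t < distr μ f s}.indicator (fun _ => rearr μ g t) s := by
    intro s
    unfold distr
    rw [withDensity_apply _ (measurableSet_lt measurable_const hf.abs.ennreal_ofReal)]
    refine (setLIntegral_abs_le g hg _).trans (le_of_eq ?_)
    exact lintegral_congr fun t => by simp [indicator]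
  refine (lintegral_mono hpt).trans ?_
  rw [lintegral_lintegral_swap]
  · refine lintegral_mono fun t => ?_
    have h1 : ∀ s, {s | ENNReal.ofReal t < distr μ f s}.indicator (fun _ => rearr μ g t) s =
        {s | ENNReal.ofReal t < distr μ f s}.indicator (fun _ => 1) s * rearr μ g t := by
      intro s
      simp [indicator]
    have hm : MeasurableSet {s | ENNReal.ofReal t < distr μ f s} :=
      measurableSet_lt measurable_const (distr_antitone f).measurable
    simp_rw [h1]
    rw [lintegral_mul_const _ (measurable_const.indicator hm)]
    gcongr
    exact lintegral_indicator_lt_distr_le f t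
  · refine Measurable.aemeasurable ?_
    have : (Function.uncurry fun s t => {s | ENNReal.ofReal t < distr μ f s}.indicator
        (fun _ => rearr μ g t) s) =
        {z : ℝ × ℝ | ENNReal.ofReal z.2 < distr μ f z.1}.indicator
          (fun z => rearr μ g z.2) := by
      ext ⟨s, t⟩
      simp [indicator, Function.uncurry]
    rw [this]
    exact ((rearr_antitone g).measurable.comp measurable_snd).indicator
      (measurableSet_lt_distr f)

/-- For a non-atomic infinite measure and a non-increasing `Φ`, there is a function `g` with
`g* ≤ Φ` that nearly attains the truncated integral of `f* Φ`. -/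
lemma exists_nearly_extremal (hna : IsNonatomic μ) (hμ : μ univ = ∞) {f : X → ℝ}
    (hf : Measurable f) {Φ : ℝ → ℝ≥0∞} (hΦ : AntitoneOn Φ (Ioi 0)) (hΦtop : ∀ t > 0, Φ t ≠ ∞)
    {δ : ℝ} (hδ : 0 < δ) {M : ℝ≥0∞} (hM : M ≠ ∞) :
    ∃ g : X → ℝ, Measurable g ∧ (∀ t > 0, rearr μ g t ≤ Φ t) ∧
      ∫⁻ t in Ici (2 * δ), min (rearr μ f t / 2) M * Φ t ≤
        2 * ∫⁻ x, ENNReal.ofReal |f x * g x| ∂μ := by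
  set T : ℕ → ℝ := fun j => δ * 2 ^ j with hT
  have hTpos : ∀ j, 0 < T j := fun j => by positivity
  have hTs : ∀ j, T (j + 1) = 2 * T j := fun j => by simp only [hT]; ring
  have hTmono : Monotone T := monotone_nat_of_le_succ fun j => by
    rw [hTs]; linarith [hTpos j]
  have hTtop : ∀ t, ∃ j, t < T j := by
    intro t
    obtain ⟨j, hj⟩ := pow_unbounded_of_one_lt (t / δ) (one_lt_two)
    exact ⟨j, by rwa [div_lt_iff₀' hδ] at hj⟩
  have hloc : ∀ i t, T i ≤ t → ∃ j, i ≤ j ∧ T j ≤ t ∧ t < T (j + 1) := by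
    intro i t hit
    classical
    have hex := hTtop t
    have hlt := Nat.find_spec hex
    have hpos : i < Nat.find hex := by
      by_contra hc
      exact absurd (hTmono (not_lt.1 hc)) (not_le.2 (lt_of_le_of_lt hit hlt))
    refine ⟨Nat.find hex - 1, by omega, ?_, ?_⟩
    · exact not_lt.1 (Nat.find_min hex (by omega))
    · rwa [Nat.sub_add_cancel (by omega)]
  set h : ℝ → ℝ≥0∞ := fun t => min (rearr μ f t / 2) M with hh
  have hanti : Antitone h := fun s t hst => by
    simp only [hh]
    exact min_le_min_right _ (ENNReal.div_le_div_right (rearr_antitone f hst) 2)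
  have hFm : Monotone fun j => {x | h (T j) ≤ ENNReal.ofReal |f x|} := fun i j hij x hx =>
    (hanti (hTmono hij)).trans hx
  have hF : ∀ j, MeasurableSet {x | h (T j) ≤ ENNReal.ofReal |f x|} := fun j =>
    measurableSet_le measurable_const hf.abs.ennreal_ofReal
  have hlarge : ∀ j, ENNReal.ofReal (T j) ≤ μ {x | h (T j) ≤ ENNReal.ofReal |f x|} := by
    intro j
    by_cases h0 : rearr μ f (T j) = 0
    · simp [hh, h0, hμ]
    · have hlt : h (T j) < rearr μ f (T j) := by
        by_cases htop : rearr μ f (T j) = ∞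
        · rw [htop]; exact (min_le_right _ _).trans_lt hM.lt_top
        · exact (min_le_left _ _).trans_lt (ENNReal.half_lt_self h0 htop)
      exact (lt_measure_of_lt_rearr hlt).le.trans (measure_mono fun x hx =>
        mem_ofPred.2 (mem_ofPred.1 hx).le)
  obtain ⟨E, hEm, hEF, hEmeas, hEμ⟩ := exists_monotone_measure_eq hna hF hFm
    (a := fun j => ENNReal.ofReal (T j))
    (fun i j hij => ENNReal.ofReal_le_ofReal (hTmono hij)) (fun j => ENNReal.ofReal_ne_top) hlarge
  set G : X → ℝ≥0∞ := fun x => ⨆ j, (E j).indicator (fun _ => Φ (T j)) x with hG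
  have hGm : Measurable G := Measurable.iSup fun j => measurable_const.indicator (hEmeas j)
  have hΦT : ∀ {i j}, i ≤ j → Φ (T j) ≤ Φ (T i) := fun hij =>
    hΦ (hTpos _) (hTpos _) (hTmono hij)
  have hG0 : ∀ x, G x ≤ Φ (T 0) := fun x => iSup_le fun j =>
    (indicator_le_self' (fun _ _ => zero_le) x).trans (hΦT (Nat.zero_le j))
  have hGtop : ∀ x, G x ≠ ∞ := fun x => ne_top_of_le_ne_top (hΦtop _ (hTpos 0)) (hG0 x)
  have hGabs : ∀ x, ENNReal.ofReal |(G x).toReal| = G x := fun x => by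
    rw [abs_of_nonneg ENNReal.toReal_nonneg, ENNReal.ofReal_toReal (hGtop x)]
  have hGout : ∀ j x, x ∉ E j → G x ≤ Φ (T (j + 1)) := by
    intro j x hx
    refine iSup_le fun i => ?_
    by_cases hxi : x ∈ E i
    · rw [indicator_of_mem hxi]
      refine hΦT ?_
      by_contra hc
      exact hx (hEm (by omega) hxi)
    · rw [indicator_of_notMem hxi]; exact zero_le
  refine ⟨fun x => (G x).toReal, hGm.ennreal_toReal, ?_, ?_⟩
  · intro t ht
    simp only [rearr, hGabs]
    rcases lt_or_ge t (T 0) with h0 | h0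
    · refine (sInf_le ?_).trans (hΦ ht (hTpos 0) h0.le)
      have : {x | Φ (T 0) < G x} = ∅ := by
        ext x; simpa using hG0 x
      simp [this]
    · obtain ⟨j, -, hj1, hj2⟩ := hloc 0 t h0
      refine (sInf_le ?_).trans (hΦ ht (hTpos (j + 1)) hj2.le)
      refine le_trans (measure_mono (t := E j) fun x hx => ?_)
        ((hEμ j).le.trans (ENNReal.ofReal_le_ofReal hj1))
      by_contra hc
      exact absurd (hGout j x hc) (not_le.2 hx)
  · have hcover : Ici (2 * δ) ⊆ ⋃ j : ℕ, Ico (T (j + 1)) (T (j + 2)) := by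
      intro t ht
      obtain ⟨j, hj, hj1, hj2⟩ := hloc 1 t (by simpa [hT, mul_comm] using ht)
      obtain ⟨k, rfl⟩ := Nat.exists_eq_add_of_le' hj
      exact mem_iUnion.2 ⟨k, hj1, hj2⟩
    have hpiece : ∀ j, ∫⁻ t in Ico (T (j + 1)) (T (j + 2)), h t * Φ t ≤
        2 * ∫⁻ x in E (j + 1) \ E j, ENNReal.ofReal |f x| * G x ∂μ := by
      intro j
      calc ∫⁻ t in Ico (T (j + 1)) (T (j + 2)), h t * Φ t
          ≤ ∫⁻ _ in Ico (T (j + 1)) (T (j + 2)), h (T (j + 1)) * Φ (T (j + 1)) := by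
            refine setLIntegral_mono measurable_const fun t ht => ?_
            exact mul_le_mul' (hanti ht.1)
              (hΦ (hTpos _) ((hTpos (j + 1)).trans_le ht.1) ht.1)
        _ = h (T (j + 1)) * Φ (T (j + 1)) * ENNReal.ofReal (2 * T j) := by
            rw [setLIntegral_const, Real.volume_Ico]
            congr 2
            rw [hTs, hTs]; ring
        _ = 2 * (h (T (j + 1)) * Φ (T (j + 1)) * ENNReal.ofReal (T j)) := by
            rw [ENNReal.ofReal_mul zero_le_two, ENNReal.ofReal_ofNat]; ring
        _ = 2 * (h (T (j + 1)) * Φ (T (j + 1)) * μ (E (j + 1) \ E j)) := by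
            congr 2
            rw [measure_sdiff (hEm j.le_succ) (hEmeas j).nullMeasurableSet
              (by rw [hEμ]; exact ENNReal.ofReal_ne_top), hEμ, hEμ,
              ← ENNReal.ofReal_sub _ (hTpos j).le, hTs]
            congr 1; ring
        _ = 2 * ∫⁻ _ in E (j + 1) \ E j, h (T (j + 1)) * Φ (T (j + 1)) ∂μ := by
            rw [setLIntegral_const]
        _ ≤ 2 * ∫⁻ x in E (j + 1) \ E j, ENNReal.ofReal |f x| * G x ∂μ := by
            gcongr 2 * ?_
            refine setLIntegral_mono (hf.abs.ennreal_ofReal.mul hGm) fun x hx => ?_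
            refine mul_le_mul' (hEF _ hx.1) ?_
            refine le_iSup_of_le (j + 1) ?_
            rw [indicator_of_mem hx.1]
    have hdisj : Pairwise (Function.onFun Disjoint fun j => E (j + 1) \ E j) := by
      have hlt : ∀ i j, i < j → Disjoint (E (i + 1) \ E i) (E (j + 1) \ E j) := fun i j hij =>
        (disjoint_sdiff_right (s := E j) (t := E (j + 1))).mono_left
          (sdiff_subset.trans (hEm (Nat.succ_le_of_lt hij)))
      intro i j hij
      rcases lt_or_gt_of_ne hij with hc | hc
      · exact hlt i j hc
      · exact (hlt j i hc).symm
    calc ∫⁻ t in Ici (2 * δ), h t * Φ t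
        ≤ ∫⁻ t in ⋃ j : ℕ, Ico (T (j + 1)) (T (j + 2)), h t * Φ t := lintegral_mono_set hcover
      _ ≤ ∑' j : ℕ, ∫⁻ t in Ico (T (j + 1)) (T (j + 2)), h t * Φ t := lintegral_iUnion_le _ _
      _ ≤ ∑' j : ℕ, 2 * ∫⁻ x in E (j + 1) \ E j, ENNReal.ofReal |f x| * G x ∂μ :=
          ENNReal.tsum_le_tsum hpiece
      _ = 2 * ∫⁻ x in ⋃ j, E (j + 1) \ E j, ENNReal.ofReal |f x| * G x ∂μ := by
          rw [ENNReal.tsum_mul_left,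
            lintegral_iUnion (fun j => (hEmeas _).diff (hEmeas _)) hdisj]
      _ ≤ 2 * ∫⁻ x, ENNReal.ofReal |f x| * G x ∂μ := by
          gcongr 2 * ?_
          exact setLIntegral_le_lintegral _ _
      _ = 2 * ∫⁻ x, ENNReal.ofReal |f x * (G x).toReal| ∂μ := by
          congr 1
          refine lintegral_congr fun x => ?_
          rw [abs_mul, ENNReal.ofReal_mul (abs_nonneg _), hGabs]

/-- Approximate resonance: if `K` dominates `∫ |f g|` for all `g` with `g* ≤ Φ`, then `4 K`
dominates `∫ f* Φ`. -/
lemma lintegral_rearr_mul_le (hna : IsNonatomic μ) (hμ : μ univ = ∞) {f : X → ℝ}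
    (hf : Measurable f) {Φ : ℝ → ℝ≥0∞} (hΦ : AntitoneOn Φ (Ioi 0)) (hΦtop : ∀ t > 0, Φ t ≠ ∞)
    {K : ℝ≥0∞} (hK : ∀ g : X → ℝ, Measurable g → (∀ t > 0, rearr μ g t ≤ Φ t) →
      ∫⁻ x, ENNReal.ofReal |f x * g x| ∂μ ≤ K) :
    ∫⁻ t in Ioi (0 : ℝ), rearr μ f t * Φ t ≤ 4 * K := by
  have hΦm : AEMeasurable Φ (volume.restrict (Ioi 0)) :=
    aemeasurable_restrict_of_antitoneOn measurableSet_Ioi hΦ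
  set F : ℕ → ℝ → ℝ≥0∞ := fun n =>
    (Ici (2 * ((n : ℝ) + 1)⁻¹)).indicator (fun t => min (rearr μ f t / 2) n * Φ t) with hF
  have hlim : ∀ t ∈ Ioi (0 : ℝ), rearr μ f t / 2 * Φ t ≤ ⨆ n, F n t := by
    intro t ht
    obtain ⟨N, hN⟩ := exists_nat_gt (2 / t)
    have hsup : rearr μ f t / 2 ≤ ⨆ n : ℕ, min (rearr μ f t / 2) ((n + N : ℕ) : ℝ≥0∞) := by
      refine le_of_forall_lt fun c hc => ?_
      obtain ⟨n, hn⟩ := ENNReal.exists_nat_gt hc.ne_top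
      refine lt_iSup_iff.2 ⟨n, lt_min hc (hn.trans_le ?_)⟩
      exact_mod_cast Nat.le_add_right n N
    calc rearr μ f t / 2 * Φ t
        ≤ (⨆ n : ℕ, min (rearr μ f t / 2) ((n + N : ℕ) : ℝ≥0∞)) * Φ t := by gcongr
      _ = ⨆ n : ℕ, min (rearr μ f t / 2) ((n + N : ℕ) : ℝ≥0∞) * Φ t := ENNReal.iSup_mul _ _
      _ ≤ ⨆ n, F n t := by
          refine iSup_le fun n => le_iSup_of_le (n + N) ?_
          have hmem : t ∈ Ici (2 * (((n + N : ℕ) : ℝ) + 1)⁻¹) := by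
            rw [mem_Ici, ← div_eq_mul_inv, div_le_iff₀ (by positivity)]
            rw [div_lt_iff₀ ht] at hN
            push_cast
            have : (0 : ℝ) ≤ t * n := mul_nonneg (le_of_lt ht) n.cast_nonneg
            have ht' : (0 : ℝ) < t := ht
            nlinarith
          simp only [hF]
          rw [indicator_of_mem hmem]
  have hFm : ∀ n, AEMeasurable (F n) (volume.restrict (Ioi 0)) := fun n =>
    ((((rearr_antitone f).measurable.div_const 2).min measurable_const).aemeasurable.mul
      hΦm).indicator measurableSet_Ici
  have hFmono : Monotone F := by
    intro m n hmn t
    simp only [hF]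
    have hmn' : (m : ℝ) ≤ n := by exact_mod_cast hmn
    have hsub : Ici (2 * ((m : ℝ) + 1)⁻¹) ⊆ Ici (2 * ((n : ℝ) + 1)⁻¹) := by
      refine Ici_subset_Ici.2 ?_
      gcongr
    refine (indicator_le_indicator_of_subset hsub (fun _ => zero_le) t).trans ?_
    refine indicator_le_indicator ?_
    gcongr
  have hFK : ∀ n, ∫⁻ t in Ioi (0 : ℝ), F n t ≤ 2 * K := by
    intro n
    obtain ⟨g, hg, hgΦ, hle⟩ := exists_nearly_extremal hna hμ hf hΦ hΦtop
      (δ := ((n : ℝ) + 1)⁻¹) (by positivity) (ENNReal.natCast_ne_top n)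
    calc ∫⁻ t in Ioi (0 : ℝ), F n t ≤ ∫⁻ t, F n t := setLIntegral_le_lintegral _ _
      _ ≤ 2 * ∫⁻ x, ENNReal.ofReal |f x * g x| ∂μ := by
          simp only [hF]
          rw [lintegral_indicator measurableSet_Ici]
          exact hle
      _ ≤ 2 * K := by gcongr; exact hK g hg hgΦ
  calc ∫⁻ t in Ioi (0 : ℝ), rearr μ f t * Φ t
      = ∫⁻ t in Ioi (0 : ℝ), 2 * (rearr μ f t / 2 * Φ t) := by
        refine lintegral_congr fun t => ?_
        rw [← mul_assoc, ENNReal.mul_div_cancel (by simp) (by simp)]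
    _ = 2 * ∫⁻ t in Ioi (0 : ℝ), rearr μ f t / 2 * Φ t := lintegral_const_mul' _ _ (by simp)
    _ ≤ 2 * ∫⁻ t in Ioi (0 : ℝ), ⨆ n, F n t := by
        gcongr 2 * ?_
        exact setLIntegral_mono' measurableSet_Ioi hlim
    _ = 2 * ⨆ n, ∫⁻ t in Ioi (0 : ℝ), F n t := by
        rw [lintegral_iSup' hFm (Eventually.of_forall fun t m n hmn => hFmono hmn t)]
    _ ≤ 2 * (2 * K) := by gcongr; exact iSup_le hFK
    _ = 4 * K := by rw [← mul_assoc]; norm_num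

lemma lkNorm_top_eq (p : ℝ≥0∞) (b : ℝ → ℝ) (g : X → ℝ) :
    lkNorm μ p ∞ b g = essSup (fun t => ENNReal.ofReal (t ^ p⁻¹.toReal * b t) * rearr μ g t)
      (volume.restrict (Ioi 0)) := by
  simp [lkNorm, lqNorm]

lemma lkNorm_conjE_one_eq {p : ℝ≥0∞} (hp : 1 ≤ p) (b : ℝ → ℝ)
    (hb : ∀ t ∈ Ioi (0 : ℝ), 0 < b t) (f : X → ℝ) :
    lkNorm μ (conjE p) 1 (fun t => (b t)⁻¹) f =
      ∫⁻ t in Ioi (0 : ℝ), rearr μ f t * (ENNReal.ofReal (t ^ p⁻¹.toReal * b t))⁻¹ := by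
  have hexp : (conjE p)⁻¹.toReal - (1 : ℝ≥0∞)⁻¹.toReal = -p⁻¹.toReal := by
    rw [conjE, inv_inv, ENNReal.toReal_sub_of_le (ENNReal.inv_le_one.2 hp) (by simp)]
    simp
  simp only [lkNorm, lqNorm, hexp, ENNReal.one_ne_top, if_false, ENNReal.toReal_one,
    ENNReal.rpow_one, div_one]
  refine setLIntegral_congr_fun measurableSet_Ioi fun t ht => ?_
  have ht' : (0 : ℝ) < t := ht
  have hbt := hb t ht
  have hw : 0 < t ^ p⁻¹.toReal * b t := mul_pos (Real.rpow_pos_of_pos ht' _) hbt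
  rw [mul_comm, ← ENNReal.ofReal_inv_of_pos hw, mul_inv, Real.rpow_neg ht'.le]

/-- The weight `t ^ (1/p) * b t` is equivalent to a non-decreasing function. -/
lemma exists_monotoneOn_equivOn {p : ℝ≥0∞} (hp : 1 ≤ p) {b : ℝ → ℝ} (hb : IsSlowlyVarying b)
    (hmono : p = ∞ → MonotoneOn b (Ioi 0)) :
    ∃ v : ℝ → ℝ, MonotoneOn v (Ioi 0) ∧
      EquivOn (fun t => t ^ p⁻¹.toReal * b t) v (Ioi 0) := by
  by_cases hpt : p = ∞
  · exact ⟨b, hmono hpt, 1, 1, one_pos, one_pos, fun t _ => by simp [hpt]⟩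
  · refine (hb.2.2 _ (ENNReal.toReal_pos ?_ ?_)).1
    · simpa using hpt
    · simpa using (zero_lt_one.trans_le hp).ne'

end LorentzKaramata

open LorentzKaramata in
/-- Theorem T3AS: for `q = ∞` and `p ∈ [1,∞]` (with `b` non-decreasing
when `p = ∞`), `(L^{p,∞,b})' = L^{p',1,b⁻¹}` up to equivalence of the defining
functionals. -/
theorem lk_assoc_q_infty {X : Type*} [MeasurableSpace X] (μ : Measure X)
    [SigmaFinite μ] (hna : IsNonatomic μ) (hμ : μ Set.univ = ∞)
    (p : ℝ≥0∞) (hp : 1 ≤ p) (b : ℝ → ℝ) (hb : IsSlowlyVarying b)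
    (hmono : p = ∞ → MonotoneOn b (Set.Ioi 0)) :
    ∃ c C : ℝ≥0∞, 0 < c ∧ C < ∞ ∧ ∀ f : X → ℝ, Measurable f →
      c * lkNorm μ (conjE p) 1 (fun t => (b t)⁻¹) f ≤
        assocNorm μ (lkNorm μ p ∞ b) f ∧
      assocNorm μ (lkNorm μ p ∞ b) f ≤
        C * lkNorm μ (conjE p) 1 (fun t => (b t)⁻¹) f := by
  obtain ⟨v, hv, c, C, hc, hC, hcv⟩ := exists_monotoneOn_equivOn hp hb hmono
  have hwpos : ∀ t ∈ Ioi (0 : ℝ), 0 < t ^ p⁻¹.toReal * b t := fun t ht =>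
    mul_pos (Real.rpow_pos_of_pos ht _) (hb.2.1 t ht)
  have hvpos : ∀ t ∈ Ioi (0 : ℝ), 0 < v t := fun t ht =>
    pos_of_mul_pos_right ((hwpos t ht).trans_le (hcv t ht).2) hC.le
  have hquot : 0 < C / c := div_pos hC hc
  refine ⟨(ENNReal.ofReal (C / c) * 4)⁻¹, 1, ?_, by simp, fun f hf => ⟨?_, ?_⟩⟩
  · exact ENNReal.inv_pos.2 (ENNReal.mul_ne_top ENNReal.ofReal_ne_top (by simp))
  · set Φ : ℝ → ℝ≥0∞ := fun t => (ENNReal.ofReal (C * v t))⁻¹ with hΦdef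
    have hΦ : AntitoneOn Φ (Ioi 0) := fun s hs t ht hst => by
      simp only [hΦdef]
      exact ENNReal.inv_le_inv.2
        (ENNReal.ofReal_le_ofReal (mul_le_mul_of_nonneg_left (hv hs ht hst) hC.le))
    have hΦtop : ∀ t > 0, Φ t ≠ ∞ := fun t ht =>
      ENNReal.inv_ne_top.2 (ENNReal.ofReal_pos.2 (mul_pos hC (hvpos t ht))).ne'
    have hK := lintegral_rearr_mul_le hna hμ hf hΦ hΦtop
      (K := assocNorm μ (lkNorm μ p ∞ b) f) fun g hg hgΦ => by
        refine le_iSup_of_le g (le_iSup_of_le hg (le_iSup_of_le ?_ le_rfl))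
        rw [lkNorm_top_eq]
        refine essSup_le_of_ae_le 1 ?_
        filter_upwards [ae_restrict_mem measurableSet_Ioi] with t ht
        calc ENNReal.ofReal (t ^ p⁻¹.toReal * b t) * rearr μ g t
            ≤ ENNReal.ofReal (C * v t) * Φ t :=
              mul_le_mul' (ENNReal.ofReal_le_ofReal (hcv t ht).2) (hgΦ t ht)
          _ ≤ 1 := ENNReal.mul_inv_le_one _
    rw [ENNReal.inv_mul_le_iff (by simp [hquot])
        (ENNReal.mul_ne_top ENNReal.ofReal_ne_top (by simp)),
      lkNorm_conjE_one_eq hp b hb.2.1, mul_assoc]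
    calc ∫⁻ t in Ioi (0 : ℝ), rearr μ f t * (ENNReal.ofReal (t ^ p⁻¹.toReal * b t))⁻¹
        ≤ ∫⁻ t in Ioi (0 : ℝ), ENNReal.ofReal (C / c) * (rearr μ f t * Φ t) := by
          refine setLIntegral_mono' measurableSet_Ioi fun t ht => ?_
          have hvt := hvpos t ht
          rw [mul_left_comm]
          gcongr
          simp only [hΦdef]
          rw [← ENNReal.ofReal_inv_of_pos (hwpos t ht),
            ← ENNReal.ofReal_inv_of_pos (mul_pos hC hvt), ← ENNReal.ofReal_mul hquot.le]
          refine ENNReal.ofReal_le_ofReal ?_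
          have : C / c * (C * v t)⁻¹ = (c * v t)⁻¹ := by field_simp
          rw [this]
          exact inv_anti₀ (mul_pos hc hvt) (hcv t ht).1
      _ = ENNReal.ofReal (C / c) * ∫⁻ t in Ioi (0 : ℝ), rearr μ f t * Φ t :=
          lintegral_const_mul' _ _ ENNReal.ofReal_ne_top
      _ ≤ ENNReal.ofReal (C / c) * (4 * assocNorm μ (lkNorm μ p ∞ b) f) := by gcongr
  · rw [one_mul, lkNorm_conjE_one_eq hp b hb.2.1]
    refine iSup_le fun g => iSup_le fun hg => iSup_le fun hN => ?_
    refine (lintegral_mul_le_lintegral_rearr_mul f g hf hg).trans (lintegral_mono_ae ?_)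
    rw [lkNorm_top_eq] at hN
    filter_upwards [ENNReal.ae_le_essSup
      (fun t => ENNReal.ofReal (t ^ p⁻¹.toReal * b t) * rearr μ g t)] with t ht
    gcongr
    exact ENNReal.le_inv_iff_mul_le.2 ((mul_comm _ _).trans_le (ht.trans hN))
end
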